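/- (Theorem 2.9, (a) ⇒ (b), converse Lyapunov theorem) Assume hypotheses (H1)–(H4) and that 0 ∈ C([−r,0]; ℝⁿ) is non-uniformly in time RGAS: there exist σ ∈ KL and β ∈ K⁺ such that every maximal solution with data (t₀, x₀, d) ∈ [0,∞) × C([−r,0]; ℝⁿ) × M_D is defined on [t₀,∞) and satisfies ‖T_r(t)x‖_r ≤ σ(β(t₀)‖x₀‖_r, t−t₀) for all t ≥ t₀. Then there exists a continuous V : [0,∞) × C([−r,0]; ℝⁿ) → [0,∞) such that: (i) there exist a₁, a₂ ∈ K∞ and β̃ ∈ K⁺ with a₁(‖x‖_r) ≤ V(t,x) ≤ a₂(β̃(t)‖x‖_r) for all (t,x); (ii) V⁰(t, x; f(t,x,d)) ≤ −V(t,x) for all (t,x,d) ∈ [0,∞) × C([−r,0]; ℝⁿ) × D; (iii) there is a non-decreasing M : [0,∞) → [0,∞) with |V(t,y) − V(t,x)| ≤ M(R)‖y−x‖_r whenever t ∈ [0,R] and ‖x‖_r, ‖y‖_r ≤ R. -/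

import Mathlib

open Set Filter MeasureTheory
open scoped RealInnerProductSpace

noncomputable section

/-- ℝⁿ with the Euclidean norm. -/
abbrev Euc (n : ℕ) : Type := EuclideanSpace ℝ (Fin n)

/-- The sup norm `‖y‖_q = max_{θ ∈ [-q,0]} |y θ|` of a history segment. -/
def histNorm (n : ℕ) (q : ℝ) (y : ℝ → Euc n) : ℝ :=
  sSup ((fun θ => ‖y θ‖) '' Icc (-q) 0)

/-- The class `M_D` of allowed disturbances: right-continuous maps `d : [0,∞) → D`
which are continuous outside a countable set with no finite accumulation point. -/
def MD (l : ℕ) (D : Set (Euc l)) (d : ℝ → Euc l) : Prop :=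
  (∀ t, 0 ≤ t → d t ∈ D) ∧
  (∀ t, 0 ≤ t → ∀ ε > 0, ∃ δ > 0, ∀ s, t ≤ s → s - t < δ → ‖d s - d t‖ < ε) ∧
  ∃ A : Set ℝ, (∀ C : ℝ, (A ∩ Icc 0 C).Finite) ∧
    ∀ t, 0 ≤ t → t ∉ A → ∀ ε > 0, ∃ δ > 0, ∀ s, 0 ≤ s → |s - t| < δ → ‖d s - d t‖ < ε

/-- The operator `E_h(x;v)`. -/
def Eop (n : ℕ) (x : ℝ → Euc n) (h : ℝ) (v : Euc n) : ℝ → Euc n :=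
  fun θ => if -h < θ then x 0 + (θ + h) • v else x (θ + h)

/-- The generalized (Dini-type) derivative
`V⁰(t,x;v) = limsup_{h→0⁺, y→0} (V(t+h, E_h(x;v)+h y) - V(t,x))/h` of a functional `V`
defined on `[0,∞) × C([-q,0];ℝⁿ)`, with values in the extended reals. -/
def Vdot (n : ℕ) (q : ℝ) (V : ℝ → (ℝ → Euc n) → ℝ) (t : ℝ)
    (x : ℝ → Euc n) (v : Euc n) : EReal :=
  ⨅ δ : Ioi (0:ℝ), ⨆ p : {p : ℝ × (ℝ → Euc n) //
      0 < p.1 ∧ p.1 < (δ : ℝ) ∧ ContinuousOn p.2 (Icc (-q) 0) ∧ histNorm n q p.2 < (δ : ℝ)},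
    (((V (t + p.1.1) (fun θ => Eop n x p.1.1 v θ + p.1.1 • p.1.2 θ) - V t x) / p.1.1 : ℝ) : EReal)

/-- The upper right Dini derivative `D⁺v(t) = limsup_{h→0⁺} (v(t+h)-v(t))/h`. -/
def DiniUpper (v : ℝ → ℝ) (t : ℝ) : EReal :=
  Filter.limsup (fun h => (((v (t + h) - v t) / h : ℝ) : EReal)) (nhdsWithin 0 (Ioi 0))

/-- Class `K∞` functions (on `[0,∞)`). -/
def IsKInf (a : ℝ → ℝ) : Prop :=
  ContinuousOn a (Ici 0) ∧ StrictMonoOn a (Ici 0) ∧ a 0 = 0 ∧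
  (∀ s, 0 ≤ s → 0 ≤ a s) ∧ Filter.Tendsto a Filter.atTop Filter.atTop

/-- Class `K⁺`: positive continuous functions on `[0,∞)`. -/
def IsKPlus (b : ℝ → ℝ) : Prop :=
  ContinuousOn b (Ici 0) ∧ ∀ t, 0 ≤ t → 0 < b t

/-- Class `KL` functions. -/
def IsKL (σ : ℝ → ℝ → ℝ) : Prop :=
  ContinuousOn (fun p : ℝ × ℝ => σ p.1 p.2) (Ici 0 ×ˢ Ici 0) ∧
  (∀ s t, 0 ≤ s → 0 ≤ t → 0 ≤ σ s t) ∧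
  (∀ t, 0 ≤ t → StrictMonoOn (fun s => σ s t) (Ici 0) ∧ σ 0 t = 0) ∧
  (∀ s, 0 ≤ s → AntitoneOn (σ s) (Ici 0)) ∧
  (∀ s, 0 ≤ s → Filter.Tendsto (σ s) Filter.atTop (nhds 0))

/-- Hypothesis (H1): a one-sided Lipschitz estimate. -/
def H1 (n l : ℕ) (r : ℝ) (D : Set (Euc l)) (f : ℝ → (ℝ → Euc n) → Euc l → Euc n) : Prop :=
  ∃ L : ℝ → ℝ → ℝ,
    ContinuousOn (fun p : ℝ × ℝ => L p.1 p.2) (Ici 0 ×ˢ Ici 0) ∧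
    (∀ t, 0 ≤ t → MonotoneOn (L t) (Ici 0)) ∧
    (∀ s, 0 ≤ s → MonotoneOn (fun t => L t s) (Ici 0)) ∧
    (∀ t s, 0 ≤ t → 0 ≤ s → 0 ≤ L t s) ∧
    ∀ t x y d, 0 ≤ t → ContinuousOn x (Icc (-r) 0) → ContinuousOn y (Icc (-r) 0) → d ∈ D →
      (inner ℝ (x 0 - y 0) (f t x d - f t y d) : ℝ) ≤
        L t (histNorm n r x + histNorm n r y) * (histNorm n r (x - y))^2

/-- Hypothesis (H2): `f` maps bounded sets to bounded sets, uniformly in `d ∈ D`. -/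
def H2 (n l : ℕ) (r : ℝ) (D : Set (Euc l)) (f : ℝ → (ℝ → Euc n) → Euc l → Euc n) : Prop :=
  ∀ Tb Rb : ℝ, ∃ C : ℝ, ∀ t x d, 0 ≤ t → t ≤ Tb → ContinuousOn x (Icc (-r) 0) →
    histNorm n r x ≤ Rb → d ∈ D → ‖f t x d‖ ≤ C

/-- Hypothesis (H3): continuity off a countable exceptional set of times with no finite
accumulation point, plus right-continuity in time everywhere. -/
def H3 (n l : ℕ) (r : ℝ) (D : Set (Euc l)) (f : ℝ → (ℝ → Euc n) → Euc l → Euc n) : Prop :=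
  ∃ A : Set ℝ, (∀ C : ℝ, (A ∩ Icc 0 C).Finite) ∧
    (∀ t x d, 0 ≤ t → t ∉ A → ContinuousOn x (Icc (-r) 0) → d ∈ D →
      ∀ ε > 0, ∃ δ > 0, ∀ t' x' d', 0 ≤ t' → ContinuousOn x' (Icc (-r) 0) → d' ∈ D →
        |t' - t| < δ → histNorm n r (x' - x) < δ → ‖d' - d‖ < δ →
          ‖f t' x' d' - f t x d‖ < ε) ∧
    (∀ t x d, 0 ≤ t → ContinuousOn x (Icc (-r) 0) → d ∈ D →
      ∀ ε > 0, ∃ δ > 0, ∀ t', t ≤ t' → t' - t < δ → ‖f t' x d - f t x d‖ < ε)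

/-- Hypothesis (H4). -/
def H4 (n l : ℕ) (r : ℝ) (D : Set (Euc l)) (f : ℝ → (ℝ → Euc n) → Euc l → Euc n) : Prop :=
  ∀ ε > 0, ∀ t, 0 ≤ t → ∃ δ > 0, ∀ τ x d, 0 ≤ τ → d ∈ D → ContinuousOn x (Icc (-r) 0) →
    |τ - t| + histNorm n r x < δ → ‖f τ x d‖ < ε

/-- A solution of the RFDE on `[t₀ - r, T)` (continuous, absolutely continuous on compact
subintervals of `[t₀,T)` and satisfying the equation a.e., expressed in integral form). -/
def IsSolIco (n l : ℕ) (r : ℝ) (f : ℝ → (ℝ → Euc n) → Euc l → Euc n) (d : ℝ → Euc l)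
    (t₀ T : ℝ) (x : ℝ → Euc n) : Prop :=
  ContinuousOn x (Ico (t₀ - r) T) ∧
  ∀ t ∈ Ico t₀ T,
    IntervalIntegrable (fun s => f s (fun θ => x (s + θ)) (d s)) volume t₀ t ∧
    x t = x t₀ + ∫ s in t₀..t, f s (fun θ => x (s + θ)) (d s)

/-- A solution of the RFDE on all of `[t₀ - r, ∞)`. -/
def IsSolGlobal (n l : ℕ) (r : ℝ) (f : ℝ → (ℝ → Euc n) → Euc l → Euc n) (d : ℝ → Euc l)
    (t₀ : ℝ) (x : ℝ → Euc n) : Prop :=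
  ContinuousOn x (Ici (t₀ - r)) ∧
  ∀ t, t₀ ≤ t →
    IntervalIntegrable (fun s => f s (fun θ => x (s + θ)) (d s)) volume t₀ t ∧
    x t = x t₀ + ∫ s in t₀..t, f s (fun θ => x (s + θ)) (d s)

/-- Non-uniform in time robust global asymptotic stability of `0` for the RFDE:
every maximal solution is defined on `[t₀,∞)` and satisfies the `KL` estimate (2.6). -/
def RGASnu (n l : ℕ) (r : ℝ) (D : Set (Euc l))
    (f : ℝ → (ℝ → Euc n) → Euc l → Euc n) : Prop :=
  ∃ σ : ℝ → ℝ → ℝ, ∃ β : ℝ → ℝ, IsKL σ ∧ IsKPlus β ∧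
    (∀ t₀ x₀ d, 0 ≤ t₀ → ContinuousOn x₀ (Icc (-r) 0) → MD l D d →
      ∃ x : ℝ → Euc n, IsSolGlobal n l r f d t₀ x ∧ ∀ θ ∈ Icc (-r) 0, x (t₀ + θ) = x₀ θ) ∧
    (∀ t₀ x₀ d x, 0 ≤ t₀ → ContinuousOn x₀ (Icc (-r) 0) → MD l D d →
      IsSolGlobal n l r f d t₀ x → (∀ θ ∈ Icc (-r) 0, x (t₀ + θ) = x₀ θ) →
      ∀ t, t₀ ≤ t →
        histNorm n r (fun θ => x (t + θ)) ≤ σ (β t₀ * histNorm n r x₀) (t - t₀))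

/-- Uniform robust global asymptotic stability of `0` for the RFDE. -/
def URGAS (n l : ℕ) (r : ℝ) (D : Set (Euc l))
    (f : ℝ → (ℝ → Euc n) → Euc l → Euc n) : Prop :=
  ∃ σ : ℝ → ℝ → ℝ, IsKL σ ∧
    (∀ t₀ x₀ d, 0 ≤ t₀ → ContinuousOn x₀ (Icc (-r) 0) → MD l D d →
      ∃ x : ℝ → Euc n, IsSolGlobal n l r f d t₀ x ∧ ∀ θ ∈ Icc (-r) 0, x (t₀ + θ) = x₀ θ) ∧
    (∀ t₀ x₀ d x, 0 ≤ t₀ → ContinuousOn x₀ (Icc (-r) 0) → MD l D d →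
      IsSolGlobal n l r f d t₀ x → (∀ θ ∈ Icc (-r) 0, x (t₀ + θ) = x₀ θ) →
      ∀ t, t₀ ≤ t →
        histNorm n r (fun θ => x (t + θ)) ≤ σ (histNorm n r x₀) (t - t₀))

section HistNorm

variable {n : ℕ} {r : ℝ}

theorem histNorm_nonneg (y : ℝ → Euc n) : 0 ≤ histNorm n r y :=
  Real.sSup_nonneg (by rintro _ ⟨θ, -, rfl⟩; exact norm_nonneg _)

theorem norm_le_histNorm {y : ℝ → Euc n} (hy : ContinuousOn y (Icc (-r) 0)) {θ : ℝ}
    (hθ : θ ∈ Icc (-r) 0) : ‖y θ‖ ≤ histNorm n r y :=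
  le_csSup (isCompact_Icc.image_of_continuousOn hy.norm).bddAbove ⟨θ, hθ, rfl⟩

theorem histNorm_le {y : ℝ → Euc n} {C : ℝ} (hC : 0 ≤ C)
    (h : ∀ θ ∈ Icc (-r) 0, ‖y θ‖ ≤ C) : histNorm n r y ≤ C :=
  Real.sSup_le (by rintro _ ⟨θ, hθ, rfl⟩; exact h θ hθ) hC

theorem histNorm_congr {x y : ℝ → Euc n} (h : ∀ θ ∈ Icc (-r) 0, x θ = y θ) :
    histNorm n r x = histNorm n r y := by
  unfold histNorm
  congr 1
  exact image_congr fun θ hθ => by rw [h θ hθ]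

theorem histNorm_le_add {x y : ℝ → Euc n} (hx : ContinuousOn x (Icc (-r) 0))
    (hy : ContinuousOn y (Icc (-r) 0)) :
    histNorm n r x ≤ histNorm n r y + histNorm n r (x - y) := by
  refine histNorm_le (add_nonneg (histNorm_nonneg _) (histNorm_nonneg _)) fun θ hθ => ?_
  have h1 := norm_le_histNorm hy hθ
  have h2 := norm_le_histNorm (hx.sub hy) hθ
  have h3 : ‖x θ‖ ≤ ‖y θ‖ + ‖x θ - y θ‖ := by
    simpa using norm_add_le (y θ) (x θ - y θ)
  have h4 : (x - y) θ = x θ - y θ := rfl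
  rw [h4] at h2
  linarith

theorem histNorm_sub_comm (x y : ℝ → Euc n) : histNorm n r (x - y) = histNorm n r (y - x) := by
  unfold histNorm
  congr 1
  exact image_congr fun θ _ => norm_sub_rev _ _

theorem abs_histNorm_sub_le {x y : ℝ → Euc n} (hx : ContinuousOn x (Icc (-r) 0))
    (hy : ContinuousOn y (Icc (-r) 0)) :
    |histNorm n r x - histNorm n r y| ≤ histNorm n r (x - y) := by
  have h1 := histNorm_le_add hx hy
  have h2 := histNorm_le_add hy hx
  rw [histNorm_sub_comm y x] at h2
  rw [abs_le]
  constructor <;> linarith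

theorem continuousOn_hist {φ : ℝ → Euc n} {t₀ s : ℝ} (hφ : ContinuousOn φ (Ici (t₀ - r)))
    (hs : t₀ ≤ s) : ContinuousOn (fun θ => φ (s + θ)) (Icc (-r) 0) := by
  refine hφ.comp (by fun_prop) fun θ hθ => ?_
  have := hθ.1
  simp only [mem_Ici]
  linarith

/-- Histories of a continuous function depend continuously on time. -/
theorem exists_histNorm_hist_sub_lt {φ : ℝ → Euc n} {t₀ : ℝ}
    (hφ : ContinuousOn φ (Ici (t₀ - r))) {s : ℝ} (hs : t₀ ≤ s) {ε : ℝ} (hε : 0 < ε) :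
    ∃ δ > 0, ∀ s', t₀ ≤ s' → |s' - s| < δ →
      histNorm n r ((fun θ => φ (s' + θ)) - fun θ => φ (s + θ)) < ε := by
  have huc : UniformContinuousOn φ (Icc (t₀ - r) (s + 1)) :=
    isCompact_Icc.uniformContinuousOn_of_continuous (hφ.mono Icc_subset_Ici_self)
  obtain ⟨δ, hδ, h⟩ := Metric.uniformContinuousOn_iff.1 huc (ε / 2) (half_pos hε)
  refine ⟨min δ 1, by positivity, fun s' hs' hss' => ?_⟩
  refine (histNorm_le (half_pos hε).le fun θ hθ => ?_).trans_lt (half_lt_self hε)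
  obtain ⟨hθ1, hθ2⟩ := hθ
  have h1 := (abs_lt.1 (hss'.trans_le (min_le_right _ _))).2
  have := h (s' + θ) ⟨by linarith, by linarith⟩ (s + θ) ⟨by linarith, by linarith⟩
    (by rw [Real.dist_eq, add_sub_add_right_eq_sub]; exact hss'.trans_le (min_le_left _ _))
  rw [dist_eq_norm] at this
  exact this.le

end HistNorm

section Disturbances

variable {l : ℕ} {D : Set (Euc l)}

theorem MD.const {d : Euc l} (hd : d ∈ D) : MD l D fun _ => d :=
  ⟨fun _ _ => hd, fun _ _ ε hε => ⟨1, one_pos, fun _ _ _ => by simpa using hε⟩,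
    ∅, by simp, fun _ _ _ ε hε => ⟨1, one_pos, fun _ _ _ => by simpa using hε⟩⟩

theorem MD.concat {d₁ d₂ : ℝ → Euc l} (h₁ : MD l D d₁) (h₂ : MD l D d₂) (T : ℝ) :
    MD l D fun s => if s < T then d₁ s else d₂ s := by
  obtain ⟨hm₁, hr₁, A₁, hA₁, hc₁⟩ := h₁
  obtain ⟨hm₂, hr₂, A₂, hA₂, hc₂⟩ := h₂
  refine ⟨fun t ht => ?_, fun t ht ε hε => ?_, A₁ ∪ A₂ ∪ {T}, fun C => ?_,
    fun t ht htA ε hε => ?_⟩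
  · dsimp only
    split_ifs
    exacts [hm₁ t ht, hm₂ t ht]
  · rcases lt_or_ge t T with hT | hT
    · obtain ⟨δ, hδ, h⟩ := hr₁ t ht ε hε
      refine ⟨min δ (T - t), lt_min hδ (by linarith), fun s hs hst => ?_⟩
      have h1 : s < T := by linarith [min_le_right δ (T - t)]
      simp only [h1, hT, if_true]
      exact h s hs (hst.trans_le (min_le_left _ _))
    · obtain ⟨δ, hδ, h⟩ := hr₂ t ht ε hε
      refine ⟨δ, hδ, fun s hs hst => ?_⟩
      simp only [not_lt.2 hT, not_lt.2 (hT.trans hs), if_false]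
      exact h s hs hst
  · refine (((hA₁ C).union (hA₂ C)).union (finite_singleton T)).subset ?_
    rintro s ⟨(h | h) | h, hs⟩
    exacts [Or.inl (Or.inl ⟨h, hs⟩), Or.inl (Or.inr ⟨h, hs⟩), Or.inr h]
  · simp only [mem_union, mem_singleton_iff, not_or] at htA
    obtain ⟨⟨h1, h2⟩, h3⟩ := htA
    rcases lt_or_gt_of_ne h3 with hT | hT
    · obtain ⟨δ, hδ, h⟩ := hc₁ t ht h1 ε hε
      refine ⟨min δ (T - t), lt_min hδ (by linarith), fun s hs hst => ?_⟩
      have h1 : s < T := by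
        linarith [min_le_right δ (T - t), (abs_lt.1 hst).2]
      simp only [h1, hT, if_true]
      exact h s hs (hst.trans_le (min_le_left _ _))
    · obtain ⟨δ, hδ, h⟩ := hc₂ t ht h2 ε hε
      refine ⟨min δ (t - T), lt_min hδ (by linarith), fun s hs hst => ?_⟩
      have h1 : T < s := by
        linarith [min_le_right δ (t - T), (abs_lt.1 hst).1]
      simp only [not_lt.2 hT.le, not_lt.2 h1.le, if_false]
      exact h s hs (hst.trans_le (min_le_left _ _))

theorem countable_inter_Ici_of_finite_inter_Icc {A : Set ℝ}
    (hA : ∀ C : ℝ, (A ∩ Icc 0 C).Finite) : (A ∩ Ici 0).Countable := by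
  refine (countable_iUnion fun k : ℕ => (hA k).countable).mono ?_
  rintro s ⟨hs, hs0⟩
  obtain ⟨k, hk⟩ := exists_nat_ge s
  exact mem_iUnion.2 ⟨k, hs, hs0, hk⟩

end Disturbances

section Solutions

variable {n l : ℕ} {r : ℝ} {D : Set (Euc l)} {f : ℝ → (ℝ → Euc n) → Euc l → Euc n}

/-- The vector field depends on the history only through its restriction to `[-r, 0]`. -/
theorem H3.eq_of_eqOn (h3 : H3 n l r D f) {t : ℝ} (ht : 0 ≤ t) {x y : ℝ → Euc n} {d : Euc l}
    (hx : ContinuousOn x (Icc (-r) 0)) (hd : d ∈ D) (hxy : ∀ θ ∈ Icc (-r) 0, x θ = y θ) :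
    f t x d = f t y d := by
  obtain ⟨A, hA, hc, hrc⟩ := h3
  have hy : ContinuousOn y (Icc (-r) 0) := hx.congr fun θ hθ => (hxy θ hθ).symm
  have key : ∀ s, 0 ≤ s → s ∉ A → f s x d = f s y d := by
    intro s hs hsA
    refine eq_of_forall_dist_le fun ε hε => ?_
    obtain ⟨δ, hδ, h⟩ := hc s y d hs hsA hy hd ε hε
    have h0 : histNorm n r (x - y) ≤ 0 :=
      histNorm_le le_rfl fun θ hθ => by simp [hxy θ hθ]
    rw [dist_eq_norm]
    exact (h s x d hs hx hd (by simpa) (h0.trans_lt hδ) (by simpa)).le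
  refine eq_of_forall_dist_le fun ε hε => ?_
  obtain ⟨δ₁, hδ₁, h₁⟩ := hrc t x d ht hx hd (ε / 2) (half_pos hε)
  obtain ⟨δ₂, hδ₂, h₂⟩ := hrc t y d ht hy hd (ε / 2) (half_pos hε)
  obtain ⟨s, hs, hsA⟩ : ∃ s ∈ Ioo t (t + min δ₁ δ₂), s ∈ (A ∩ Ici 0)ᶜ :=
    ((countable_inter_Ici_of_finite_inter_Icc hA).dense_compl ℝ).exists_mem_open isOpen_Ioo
      (nonempty_Ioo.2 (by linarith [lt_min hδ₁ hδ₂])) |>.imp fun s h => ⟨h.2, h.1⟩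
  have hs0 : 0 ≤ s := ht.trans hs.1.le
  have e := key s hs0 fun h => hsA ⟨h, hs0⟩
  have e₁ := h₁ s hs.1.le (by linarith [hs.2, min_le_left δ₁ δ₂])
  have e₂ := h₂ s hs.1.le (by linarith [hs.2, min_le_right δ₁ δ₂])
  rw [e, ← dist_eq_norm, dist_comm] at e₁
  rw [← dist_eq_norm] at e₂
  linarith [dist_triangle (f t x d) (f s y d) (f t y d)]

theorem IsSolGlobal.restart {d : ℝ → Euc l} {t₀ t₁ : ℝ} {φ : ℝ → Euc n}
    (hφ : IsSolGlobal n l r f d t₀ φ) (h : t₀ ≤ t₁) : IsSolGlobal n l r f d t₁ φ := by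
  obtain ⟨hc, hi⟩ := hφ
  refine ⟨hc.mono (Ici_subset_Ici.2 (by linarith)), fun t ht => ?_⟩
  obtain ⟨i₁, e₁⟩ := hi t₁ h
  obtain ⟨i₂, e₂⟩ := hi t (h.trans ht)
  refine ⟨i₁.symm.trans i₂, ?_⟩
  rw [e₂, e₁, add_assoc, intervalIntegral.integral_add_adjacent_intervals i₁ (i₁.symm.trans i₂)]

theorem IsSolGlobal.concat (h3 : H3 n l r D f) {d₁ d₂ : ℝ → Euc l} {t₀ t₁ : ℝ}
    {φ ψ : ℝ → Euc n} (hr : 0 ≤ r) (ht₀ : 0 ≤ t₀) (h : t₀ ≤ t₁)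
    (hd₁ : MD l D d₁) (hd₂ : MD l D d₂)
    (hφ : IsSolGlobal n l r f d₁ t₀ φ) (hψ : IsSolGlobal n l r f d₂ t₁ ψ)
    (hφψ : ∀ θ ∈ Icc (-r) 0, ψ (t₁ + θ) = φ (t₁ + θ)) :
    IsSolGlobal n l r f (fun s => if s < t₁ then d₁ s else d₂ s) t₀
      (fun s => if s < t₁ then φ s else ψ s) := by
  set χ : ℝ → Euc n := fun s => if s < t₁ then φ s else ψ s with hχ
  have hag : ∀ s, t₁ - r ≤ s → s ≤ t₁ → ψ s = φ s := fun s h1 h2 => by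
    simpa using hφψ (s - t₁) ⟨by linarith, by linarith⟩
  have hχφ : ∀ s, s ≤ t₁ → χ s = φ s := fun s hs => by
    rcases hs.lt_or_eq with h | h
    · simp [hχ, h]
    · simp only [hχ, h, lt_irrefl, if_false]
      exact hag t₁ (by linarith) le_rfl
  have hχψ : ∀ s, t₁ - r ≤ s → χ s = ψ s := fun s hs => by
    rcases lt_or_ge s t₁ with h | h
    · simp only [hχ, h, if_true]
      exact (hag s hs h.le).symm
    · simp [hχ, not_lt.2 h]
  have hE₁ : ∀ s, t₀ ≤ s → s < t₁ →
      f s (fun θ => χ (s + θ)) (if s < t₁ then d₁ s else d₂ s)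
        = f s (fun θ => φ (s + θ)) (d₁ s) := fun s hs hs' => by
    rw [if_pos hs']
    refine (h3.eq_of_eqOn (ht₀.trans hs) (continuousOn_hist hφ.1 hs) (hd₁.1 s (ht₀.trans hs))
      fun θ hθ => (hχφ _ ?_).symm).symm
    linarith [hθ.2]
  have hE₂ : ∀ s, t₁ ≤ s →
      f s (fun θ => χ (s + θ)) (if s < t₁ then d₁ s else d₂ s)
        = f s (fun θ => ψ (s + θ)) (d₂ s) := fun s hs => by
    rw [if_neg (not_lt.2 hs)]
    have hs0 : 0 ≤ s := ht₀.trans (h.trans hs)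
    refine (h3.eq_of_eqOn hs0 (continuousOn_hist hψ.1 hs) (hd₂.1 s hs0)
      fun θ hθ => (hχψ _ ?_).symm).symm
    linarith [hθ.1]
  have part₁ : ∀ t, t₀ ≤ t → t ≤ t₁ →
      IntervalIntegrable (fun s => f s (fun θ => χ (s + θ)) (if s < t₁ then d₁ s else d₂ s))
        volume t₀ t ∧
      χ t = χ t₀ + ∫ s in t₀..t, f s (fun θ => χ (s + θ)) (if s < t₁ then d₁ s else d₂ s) := by
    intro t h0 h1
    obtain ⟨i, e⟩ := hφ.2 t h0
    have hae : ∀ᵐ s, s ∈ uIoc t₀ t → f s (fun θ => φ (s + θ)) (d₁ s) =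
        f s (fun θ => χ (s + θ)) (if s < t₁ then d₁ s else d₂ s) := by
      filter_upwards [(countable_singleton t₁).ae_notMem volume] with s hs hmem
      rw [uIoc_of_le h0] at hmem
      exact (hE₁ s hmem.1.le (lt_of_le_of_ne (hmem.2.trans h1) hs)).symm
    refine ⟨i.congr_ae ((ae_restrict_iff' measurableSet_uIoc).2 hae), ?_⟩
    rw [← intervalIntegral.integral_congr_ae hae, hχφ t h1, hχφ t₀ h, e]
  have part₂ : ∀ t, t₁ ≤ t →
      IntervalIntegrable (fun s => f s (fun θ => χ (s + θ)) (if s < t₁ then d₁ s else d₂ s))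
        volume t₁ t ∧
      χ t = χ t₁ + ∫ s in t₁..t, f s (fun θ => χ (s + θ)) (if s < t₁ then d₁ s else d₂ s) := by
    intro t h1
    obtain ⟨i, e⟩ := hψ.2 t h1
    have hae : EqOn (fun s => f s (fun θ => ψ (s + θ)) (d₂ s))
        (fun s => f s (fun θ => χ (s + θ)) (if s < t₁ then d₁ s else d₂ s)) (uIcc t₁ t) := by
      intro s hs
      rw [uIcc_of_le h1] at hs
      exact (hE₂ s hs.1).symm
    refine ⟨i.congr (hae.mono uIoc_subset_uIcc), ?_⟩
    rw [← intervalIntegral.integral_congr hae, hχψ t (by linarith), hχψ t₁ (by linarith), e]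
  refine ⟨?_, fun t ht => ?_⟩
  · have h1 : ContinuousOn χ (Icc (t₀ - r) t₁) :=
      (hφ.1.mono Icc_subset_Ici_self).congr fun s hs => hχφ s hs.2
    have h2 : ContinuousOn χ (Ici t₁) :=
      (hψ.1.mono (Ici_subset_Ici.2 (by linarith))).congr fun s hs =>
        hχψ s (by linarith [mem_Ici.1 hs])
    rw [← Icc_union_Ici_eq_Ici (show t₀ - r ≤ t₁ by linarith)]
    exact h1.union_of_isClosed h2 isClosed_Icc isClosed_Ici
  · rcases le_total t t₁ with h1 | h1
    · exact part₁ t ht h1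
    · obtain ⟨i₁, e₁⟩ := part₁ t₁ h le_rfl
      obtain ⟨i₂, e₂⟩ := part₂ t h1
      refine ⟨i₁.trans i₂, ?_⟩
      rw [e₂, e₁, add_assoc, intervalIntegral.integral_add_adjacent_intervals i₁ i₂]

/-- At a time where neither the field nor the disturbance jumps, the right-hand side along a
solution is continuous. -/
theorem exists_norm_rhs_sub_lt {A : Set ℝ}
    (hc : ∀ t x d, 0 ≤ t → t ∉ A → ContinuousOn x (Icc (-r) 0) → d ∈ D →
      ∀ ε > 0, ∃ δ > 0, ∀ t' x' d', 0 ≤ t' → ContinuousOn x' (Icc (-r) 0) → d' ∈ D →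
        |t' - t| < δ → histNorm n r (x' - x) < δ → ‖d' - d‖ < δ →
          ‖f t' x' d' - f t x d‖ < ε)
    {d : ℝ → Euc l} {t₀ s : ℝ} {φ : ℝ → Euc n} (ht₀ : 0 ≤ t₀) (hs : t₀ ≤ s)
    (hsA : s ∉ A) (hdD : ∀ t, 0 ≤ t → d t ∈ D)
    (hds : ∀ ε > 0, ∃ δ > 0, ∀ s', 0 ≤ s' → |s' - s| < δ → ‖d s' - d s‖ < ε)
    (hφ : ContinuousOn φ (Ici (t₀ - r))) {ε : ℝ} (hε : 0 < ε) :
    ∃ δ > 0, ∀ s', t₀ ≤ s' → |s' - s| < δ →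
      ‖f s' (fun θ => φ (s' + θ)) (d s') - f s (fun θ => φ (s + θ)) (d s)‖ < ε := by
  have hs0 : 0 ≤ s := ht₀.trans hs
  obtain ⟨δ, hδ, h⟩ := hc s _ (d s) hs0 hsA (continuousOn_hist hφ hs) (hdD s hs0) ε hε
  obtain ⟨δ₁, hδ₁, h₁⟩ := exists_histNorm_hist_sub_lt hφ hs hδ
  obtain ⟨δ₂, hδ₂, h₂⟩ := hds δ hδ
  refine ⟨min δ (min δ₁ δ₂), by positivity, fun s' hs' hss' => ?_⟩
  have hs0' : 0 ≤ s' := ht₀.trans hs'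
  simp only [lt_min_iff] at hss'
  exact h s' _ (d s') hs0' (continuousOn_hist hφ hs') (hdD s' hs0') hss'.1
    (h₁ s' hs' hss'.2.1) (h₂ s' hs0' hss'.2.2)

theorem IsSolGlobal.hasDerivAt {d : ℝ → Euc l} {t₀ s : ℝ} {φ : ℝ → Euc n}
    (hφ : IsSolGlobal n l r f d t₀ φ) (hs : t₀ < s)
    (hcont : ContinuousAt (fun s => f s (fun θ => φ (s + θ)) (d s)) s) :
    HasDerivAt φ (f s (fun θ => φ (s + θ)) (d s)) s := by
  have hintg := (hφ.2 (s + 1) (by linarith)).1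
  have hsm : StronglyMeasurableAtFilter (fun s => f s (fun θ => φ (s + θ)) (d s)) (nhds s) := by
    refine ⟨Ioc t₀ (s + 1), Ioc_mem_nhds hs (by linarith), ?_⟩
    exact ((intervalIntegrable_iff_integrableOn_Ioc_of_le (by linarith)).1 hintg).aestronglyMeasurable
  have hd := (intervalIntegral.integral_hasDerivAt_right (hφ.2 s hs.le).1 hsm hcont).const_add
    (φ t₀)
  refine hd.congr_of_eventuallyEq ?_
  filter_upwards [Ioi_mem_nhds hs] with u hu
  exact (hφ.2 u (le_of_lt hu)).2

end Solutions

section LipschitzDependence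

variable {n l : ℕ} {r : ℝ} {D : Set (Euc l)} {f : ℝ → (ℝ → Euc n) → Euc l → Euc n}

theorem IsSolGlobal.norm_sub_sq_eq (h3 : H3 n l r D f) {d : ℝ → Euc l}
    {t₀ t : ℝ} {φ ψ : ℝ → Euc n} (ht₀ : 0 ≤ t₀) (hr : 0 ≤ r) (hd : MD l D d)
    (hφ : IsSolGlobal n l r f d t₀ φ) (hψ : IsSolGlobal n l r f d t₀ ψ) (ht : t₀ ≤ t) :
    IntervalIntegrable (fun s => 2 * inner ℝ (φ s - ψ s)
      (f s (fun θ => φ (s + θ)) (d s) - f s (fun θ => ψ (s + θ)) (d s))) volume t₀ t ∧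
    ∫ s in t₀..t, 2 * inner ℝ (φ s - ψ s)
      (f s (fun θ => φ (s + θ)) (d s) - f s (fun θ => ψ (s + θ)) (d s))
      = ‖φ t - ψ t‖ ^ 2 - ‖φ t₀ - ψ t₀‖ ^ 2 := by
  obtain ⟨A, hA, hc, -⟩ := h3
  obtain ⟨hdD, -, A', hA', hdc⟩ := hd
  have hcz : ContinuousOn (fun s => φ s - ψ s) (Icc t₀ t) :=
    (hφ.1.sub hψ.1).mono fun s hs => by
      simp only [mem_Ici]
      linarith [hs.1]
  have hintg := (hφ.2 t ht).1.sub (hψ.2 t ht).1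
  have hI : IntervalIntegrable (fun s => 2 * inner ℝ (φ s - ψ s)
      (f s (fun θ => φ (s + θ)) (d s) - f s (fun θ => ψ (s + θ)) (d s))) volume t₀ t := by
    rw [intervalIntegrable_iff_integrableOn_Ioc_of_le ht] at hintg ⊢
    obtain ⟨C, hC⟩ := isCompact_Icc.exists_bound_of_continuousOn hcz
    refine (hintg.norm.const_mul (2 * C)).mono' ?_ ?_
    · refine (AEStronglyMeasurable.inner (𝕜 := ℝ) ?_ hintg.aestronglyMeasurable).const_mul 2
      exact (hcz.mono Ioc_subset_Icc_self).aestronglyMeasurable measurableSet_Ioc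
    · filter_upwards [ae_restrict_mem measurableSet_Ioc] with s hs
      have h1 := hC s (Ioc_subset_Icc_self hs)
      have h2 := norm_inner_le_norm (𝕜 := ℝ) (φ s - ψ s)
        (f s (fun θ => φ (s + θ)) (d s) - f s (fun θ => ψ (s + θ)) (d s))
      have h3 := mul_le_mul_of_nonneg_right h1
        (norm_nonneg (f s (fun θ => φ (s + θ)) (d s) - f s (fun θ => ψ (s + θ)) (d s)))
      rw [norm_mul, Real.norm_ofNat, mul_assoc]
      exact mul_le_mul_of_nonneg_left (h2.trans h3) zero_le_two
  refine ⟨hI, ?_⟩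
  refine MeasureTheory.integral_eq_of_hasDerivAt_off_countable (fun s => ‖φ s - ψ s‖ ^ 2) _
    ((countable_inter_Ici_of_finite_inter_Icc hA).union
      (countable_inter_Ici_of_finite_inter_Icc hA')) ?_ ?_ hI
  · rw [uIcc_of_le ht]
    exact hcz.norm.pow 2
  · rintro s ⟨hs, hsA⟩
    rw [min_eq_left ht, max_eq_right ht] at hs
    have hs0 : 0 ≤ s := ht₀.trans hs.1.le
    simp only [mem_union, mem_inter_iff, mem_Ici, hs0, and_true, not_or] at hsA
    have cont : ∀ χ : ℝ → Euc n, IsSolGlobal n l r f d t₀ χ →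
        ContinuousAt (fun s => f s (fun θ => χ (s + θ)) (d s)) s := by
      intro χ hχ
      refine Metric.continuousAt_iff.2 fun ε hε => ?_
      obtain ⟨δ, hδ, h⟩ := exists_norm_rhs_sub_lt hc ht₀ hs.1.le hsA.1 hdD
        (hdc s hs0 hsA.2) hχ.1 hε
      refine ⟨min δ (s - t₀), lt_min hδ (sub_pos.2 hs.1), fun {s'} hs' => ?_⟩
      rw [Real.dist_eq, lt_min_iff] at hs'
      rw [dist_eq_norm]
      exact h s' (by linarith [(abs_lt.1 hs'.2).1]) hs'.1
    have hz := (hφ.hasDerivAt hs.1 (cont φ hφ)).sub (hψ.hasDerivAt hs.1 (cont ψ hψ))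
    exact hz.norm_sq

/-- Lipschitz dependence of solutions on the initial history, from a one-sided Lipschitz bound
along the two solutions. -/
theorem IsSolGlobal.histNorm_sub_le (h3 : H3 n l r D f) {d : ℝ → Euc l}
    {t₀ T K : ℝ} {φ ψ : ℝ → Euc n} (ht₀ : 0 ≤ t₀) (hr : 0 ≤ r) (hd : MD l D d)
    (hφ : IsSolGlobal n l r f d t₀ φ) (hψ : IsSolGlobal n l r f d t₀ ψ) (hT : t₀ ≤ T)
    (hK : 0 ≤ K)
    (hlip : ∀ s ∈ Icc t₀ T, inner ℝ (φ s - ψ s)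
      (f s (fun θ => φ (s + θ)) (d s) - f s (fun θ => ψ (s + θ)) (d s)) ≤
        K * histNorm n r ((fun θ => φ (s + θ)) - fun θ => ψ (s + θ)) ^ 2)
    {τ : ℝ} (hτ : τ ∈ Icc t₀ T) :
    histNorm n r ((fun θ => φ (τ + θ)) - fun θ => ψ (τ + θ)) ≤
      2 * Real.exp ((4 * K + 4) * (T - t₀)) *
        histNorm n r ((fun θ => φ (t₀ + θ)) - fun θ => ψ (t₀ + θ)) := by
  set c := 4 * K + 4 with hcdef
  have hc : 0 < c := by linarith
  set m := histNorm n r ((fun θ => φ (t₀ + θ)) - fun θ => ψ (t₀ + θ)) with hm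
  have hm0 : 0 ≤ m := histNorm_nonneg _
  have hcz : ContinuousOn (fun s => φ s - ψ s) (Icc t₀ T) :=
    (hφ.1.sub hψ.1).mono fun s hs => by
      simp only [mem_Ici]
      linarith [hs.1]
  have hpast : ∀ s, t₀ - r ≤ s → s ≤ t₀ → ‖φ s - ψ s‖ ≤ m := fun s h1 h2 => by
    have := norm_le_histNorm (n := n) (r := r)
      ((continuousOn_hist hφ.1 le_rfl).sub (continuousOn_hist hψ.1 le_rfl))
      (θ := s - t₀) ⟨by linarith, by linarith⟩
    simpa using this
  obtain ⟨s₀, hs₀, hmax⟩ := isCompact_Icc.exists_isMaxOn ⟨t₀, le_rfl, hT⟩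
    (show ContinuousOn (fun s => ‖φ s - ψ s‖ ^ 2 * Real.exp (-(c * (s - t₀)))) (Icc t₀ T) from
      (hcz.norm.pow 2).mul (by fun_prop))
  set B := ‖φ s₀ - ψ s₀‖ ^ 2 * Real.exp (-(c * (s₀ - t₀))) with hB
  have hB0 : 0 ≤ B := by positivity
  have hle : ∀ s ∈ Icc t₀ T, ‖φ s - ψ s‖ ^ 2 ≤ B * Real.exp (c * (s - t₀)) := fun s hs => by
    have h1 : ‖φ s - ψ s‖ ^ 2 * Real.exp (-(c * (s - t₀))) ≤ B := hmax hs
    rwa [Real.exp_neg, ← div_eq_mul_inv, div_le_iff₀ (Real.exp_pos _)] at h1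
  have hhist : ∀ s ∈ Icc t₀ T,
      histNorm n r ((fun θ => φ (s + θ)) - fun θ => ψ (s + θ)) ^ 2 ≤
        (m ^ 2 + B) * Real.exp (c * (s - t₀)) := by
    intro s hs
    have hpos : 0 ≤ (m ^ 2 + B) * Real.exp (c * (s - t₀)) := by positivity
    rw [← Real.le_sqrt (histNorm_nonneg _) hpos]
    refine histNorm_le (Real.sqrt_nonneg _) fun θ hθ => Real.le_sqrt_of_sq_le ?_
    change ‖φ (s + θ) - ψ (s + θ)‖ ^ 2 ≤ _
    have hone : 1 ≤ Real.exp (c * (s - t₀)) :=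
      Real.one_le_exp (mul_nonneg hc.le (by linarith [hs.1]))
    rcases le_total (s + θ) t₀ with h | h
    · have h1 := hpast (s + θ) (by linarith [hs.1, hθ.1]) h
      have h2 : ‖φ (s + θ) - ψ (s + θ)‖ ^ 2 ≤ m ^ 2 := by gcongr
      nlinarith [sq_nonneg m]
    · have h1 := hle (s + θ) ⟨h, by linarith [hs.2, hθ.2]⟩
      have h2 : Real.exp (c * (s + θ - t₀)) ≤ Real.exp (c * (s - t₀)) :=
        Real.exp_le_exp.2 (mul_le_mul_of_nonneg_left (by linarith [hθ.2]) hc.le)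
      nlinarith [sq_nonneg m, Real.exp_pos (c * (s - t₀))]
  have hBm : B ≤ 3 * m ^ 2 := by
    obtain ⟨hI, e⟩ := hφ.norm_sub_sq_eq h3 ht₀ hr hd hψ hs₀.1
    set E := Real.exp (c * (s₀ - t₀)) with hE
    have hE1 : 1 ≤ E := Real.one_le_exp (mul_nonneg hc.le (by linarith [hs₀.1]))
    have hder : ∫ s in t₀..s₀, 2 * K * (m ^ 2 + B) * Real.exp (c * (s - t₀)) =
        2 * K * (m ^ 2 + B) / c * Real.exp (c * (s₀ - t₀)) -
          2 * K * (m ^ 2 + B) / c * Real.exp (c * (t₀ - t₀)) := by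
      refine intervalIntegral.integral_eq_sub_of_hasDerivAt
        (f := fun s => 2 * K * (m ^ 2 + B) / c * Real.exp (c * (s - t₀))) (fun s _ => ?_)
        (Continuous.intervalIntegrable (by fun_prop) _ _)
      have := ((((hasDerivAt_id s).sub_const t₀).const_mul c).exp).const_mul
        (2 * K * (m ^ 2 + B) / c)
      refine this.congr_deriv ?_
      simp only [id_eq]
      field_simp
    have hmono := intervalIntegral.integral_mono_on (g := fun s =>
        2 * K * (m ^ 2 + B) * Real.exp (c * (s - t₀))) hs₀.1 hI
        (Continuous.intervalIntegrable (by fun_prop) _ _) fun s hs => by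
      have hs' : s ∈ Icc t₀ T := ⟨hs.1, hs.2.trans hs₀.2⟩
      have h1 := hlip s hs'
      have h2 := mul_le_mul_of_nonneg_left (hhist s hs') hK
      linarith
    rw [hder, e] at hmono
    simp only [sub_self, mul_zero, Real.exp_zero, mul_one] at hmono
    have h0 : ‖φ t₀ - ψ t₀‖ ^ 2 ≤ m ^ 2 := by
      gcongr
      exact hpast t₀ (by linarith) le_rfl
    have hq : 2 * K * (m ^ 2 + B) / c ≤ (m ^ 2 + B) / 2 := by
      rw [div_le_div_iff₀ hc two_pos]
      nlinarith [mul_nonneg hK (add_nonneg (sq_nonneg m) hB0), sq_nonneg m]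
    have hq0 : 0 ≤ 2 * K * (m ^ 2 + B) / c := by positivity
    have hBE : ‖φ s₀ - ψ s₀‖ ^ 2 = B * E := by
      rw [hB, hE, mul_assoc, ← Real.exp_add]
      simp
    rw [← hE, hBE] at hmono
    have h5 : B * E ≤ (m ^ 2 + (m ^ 2 + B) / 2) * E := by
      nlinarith [mul_le_mul_of_nonneg_right hq (zero_le_one.trans hE1), sq_nonneg m]
    have h6 := le_of_mul_le_mul_right h5 (zero_lt_one.trans_le hE1)
    linarith
  have hfin := hhist τ hτ
  set E := Real.exp (c * (T - t₀)) with hE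
  have hE1 : 1 ≤ E := Real.one_le_exp (mul_nonneg hc.le (by linarith))
  have hEτ : Real.exp (c * (τ - t₀)) ≤ E :=
    Real.exp_le_exp.2 (mul_le_mul_of_nonneg_left (by linarith [hτ.2]) hc.le)
  refine le_of_sq_le_sq ?_ (by positivity)
  calc _ ≤ (m ^ 2 + B) * Real.exp (c * (τ - t₀)) := hfin
    _ ≤ (4 * m ^ 2) * E := by
      apply mul_le_mul _ hEτ (Real.exp_pos _).le (by positivity)
      linarith
    _ ≤ (4 * m ^ 2) * E ^ 2 := by
      apply mul_le_mul_of_nonneg_left _ (by positivity)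
      nlinarith
    _ = (2 * E * m) ^ 2 := by ring

end LipschitzDependence

section DeadZones

/-- A weighted sum of the dead-zone functions `s ↦ max 0 (s - 1 / (q + 1))`. -/
def deadZoneSum (c : ℕ → ℝ) (s : ℝ) : ℝ := ∑' q : ℕ, c q * max 0 (s - 1 / ((q : ℝ) + 1))

variable {c : ℕ → ℝ}

theorem deadZone_le_abs (s : ℝ) (q : ℕ) : max 0 (s - 1 / ((q : ℝ) + 1)) ≤ |s| := by
  have : 0 < 1 / ((q : ℝ) + 1) := by positivity
  exact max_le (abs_nonneg s) (by linarith [le_abs_self s])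

theorem summable_deadZone (hc : ∀ q, 0 < c q) (hs : Summable c) (s : ℝ) :
    Summable fun q : ℕ => c q * max 0 (s - 1 / ((q : ℝ) + 1)) :=
  (hs.mul_right |s|).of_nonneg_of_le (fun q => mul_nonneg (hc q).le (le_max_left _ _))
    fun q => mul_le_mul_of_nonneg_left (deadZone_le_abs s q) (hc q).le

theorem mul_abs_deadZoneSum_sub_le (hc : ∀ q, 0 < c q) (hs : Summable c) {g : ℕ → ℝ}
    (hg : Summable fun q => c q * g q) {e B s s' : ℝ} (he : 0 ≤ e)
    (h : ∀ q : ℕ, e * |max 0 (s - 1 / ((q : ℝ) + 1)) - max 0 (s' - 1 / ((q : ℝ) + 1))| ≤ g q * B) :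
    e * |deadZoneSum c s - deadZoneSum c s'| ≤ (∑' q, c q * g q) * B := by
  have hd := (summable_deadZone hc hs s).sub (summable_deadZone hc hs s')
  rw [deadZoneSum, deadZoneSum,
    ← (summable_deadZone hc hs s).tsum_sub (summable_deadZone hc hs s'), ← abs_of_nonneg he,
    ← abs_mul, ← tsum_mul_left, ← Real.norm_eq_abs]
  refine tsum_of_norm_bounded (hg.hasSum.mul_right B) fun q => ?_
  rw [Real.norm_eq_abs, ← mul_sub, abs_mul, abs_mul, abs_of_nonneg he, abs_of_pos (hc q)]
  nlinarith [mul_le_mul_of_nonneg_left (h q) (hc q).le]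

theorem abs_deadZoneSum_sub_le (hc : ∀ q, 0 < c q) (hs : Summable c) (s s' : ℝ) :
    |deadZoneSum c s - deadZoneSum c s'| ≤ (∑' q, c q) * |s - s'| := by
  have := mul_abs_deadZoneSum_sub_le (g := fun _ => 1) (e := 1) (B := |s - s'|) (s := s) (s' := s')
    hc hs (by simpa using hs) zero_le_one fun q => by
      rw [one_mul, one_mul]
      refine (abs_max_sub_max_le_max _ _ _ _).trans ?_
      simp
  simpa using this

theorem isKInf_deadZoneSum (hc : ∀ q, 0 < c q) (hs : Summable c) : IsKInf (deadZoneSum c) := by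
  have hzero : deadZoneSum c 0 = 0 := by
    have : ∀ q : ℕ, c q * max 0 (0 - 1 / ((q : ℝ) + 1)) = 0 := fun q => by
      have : 0 < 1 / ((q : ℝ) + 1) := by positivity
      rw [max_eq_left (by linarith), mul_zero]
    simp only [deadZoneSum, this, tsum_zero]
  refine ⟨?_, ?_, hzero, fun s _ => tsum_nonneg fun q => mul_nonneg (hc q).le (le_max_left _ _), ?_⟩
  · refine (LipschitzWith.of_dist_le_mul (K := (∑' q, c q).toNNReal) fun s s' => ?_).continuous.continuousOn
    rw [Real.dist_eq, Real.dist_eq, Real.coe_toNNReal _ (tsum_nonneg fun q => (hc q).le)]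
    exact abs_deadZoneSum_sub_le hc hs s s'
  · intro s hs0 s' hs0' hss'
    have hs0 : 0 ≤ s := hs0
    obtain ⟨q, hq⟩ := exists_nat_one_div_lt (hs0.trans_lt hss')
    refine (summable_deadZone hc hs s).tsum_lt_tsum (i := q) (fun q => ?_) ?_
      (summable_deadZone hc hs s')
    · exact mul_le_mul_of_nonneg_left (max_le_max le_rfl (by linarith)) (hc q).le
    · refine mul_lt_mul_of_pos_left ?_ (hc q)
      exact max_lt (lt_max_of_lt_right (by linarith)) (lt_max_of_lt_right (by linarith))
  · refine tendsto_atTop_mono (f := fun s => c 0 * (s - 1)) (fun s => ?_)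
      ((tendsto_atTop_add_const_right _ (-1) tendsto_id).const_mul_atTop (hc 0))
    refine le_trans ?_ ((summable_deadZone hc hs s).le_tsum 0 fun q _ =>
      mul_nonneg (hc q).le (le_max_left _ _))
    refine mul_le_mul_of_nonneg_left ?_ (hc 0).le
    simp

/-- Weights that tame every row of a doubly indexed family, along the diagonal. -/
theorem exists_summable_weights {G : ℕ → ℕ → ℝ} (hG : ∀ q N, 0 ≤ G q N) :
    ∃ c : ℕ → ℝ, (∀ q, 0 < c q) ∧ Summable c ∧
      ∀ N, Summable fun q => c q * G q (max q N) := by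
  have hgeo : Summable fun q : ℕ => ((1 : ℝ) / 2) ^ q := summable_geometric_two
  have hpos : ∀ q, 0 < 1 + G q q := fun q => by linarith [hG q q]
  refine ⟨fun q => (1 / 2) ^ q / (1 + G q q), fun q => div_pos (by positivity) (hpos q), ?_,
    fun N => ?_⟩
  · refine hgeo.of_nonneg_of_le (fun q => (div_pos (by positivity) (hpos q)).le) fun q => ?_
    exact div_le_self (by positivity) (by linarith [hG q q])
  · rw [← summable_nat_add_iff N]
    refine ((summable_nat_add_iff N).2 hgeo).of_nonneg_of_le
      (fun q => mul_nonneg (div_pos (by positivity) (hpos _)).le (hG _ _)) fun q => ?_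
    rw [max_eq_left (Nat.le_add_left N q), div_mul_eq_mul_div, div_le_iff₀ (hpos _)]
    exact mul_le_mul_of_nonneg_left (by linarith) (by positivity)

end DeadZones

section Constants

variable {n l : ℕ} {r : ℝ} {D : Set (Euc l)} {f : ℝ → (ℝ → Euc n) → Euc l → Euc n}

/-- `φ` is a global solution from time `t` with initial history `x` and disturbance `d`. -/
def IsSolFrom (n l : ℕ) (r : ℝ) (D : Set (Euc l)) (f : ℝ → (ℝ → Euc n) → Euc l → Euc n)
    (t : ℝ) (x : ℝ → Euc n) (d : ℝ → Euc l) (φ : ℝ → Euc n) : Prop :=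
  MD l D d ∧ IsSolGlobal n l r f d t φ ∧ ∀ θ ∈ Icc (-r) 0, φ (t + θ) = x θ

theorem RGASnu.exists_isSolFrom (h : RGASnu n l r D f) {t : ℝ} {x : ℝ → Euc n} {d : ℝ → Euc l}
    (ht : 0 ≤ t) (hx : ContinuousOn x (Icc (-r) 0)) (hd : MD l D d) :
    ∃ φ, IsSolFrom n l r D f t x d φ := by
  obtain ⟨σ, β, -, -, hex, -⟩ := h
  obtain ⟨φ, h1, h2⟩ := hex t x d ht hx hd
  exact ⟨φ, hd, h1, h2⟩

theorem RGASnu.histNorm_eq_zero (h : RGASnu n l r D f) {t τ : ℝ} {x : ℝ → Euc n}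
    {d : ℝ → Euc l} {φ : ℝ → Euc n} (ht : 0 ≤ t) (hx : ContinuousOn x (Icc (-r) 0))
    (hφ : IsSolFrom n l r D f t x d φ) (hx0 : histNorm n r x = 0) (hτ : t ≤ τ) :
    histNorm n r (fun θ => φ (τ + θ)) = 0 := by
  obtain ⟨σ, β, hσ, -, -, hest⟩ := h
  have := hest t x d φ ht hx hφ.1 hφ.2.1 hφ.2.2 τ hτ
  rw [hx0, mul_zero, (hσ.2.2.1 (τ - t) (by linarith)).2] at this
  exact le_antisymm this (histNorm_nonneg _)

/-- On bounded sets of initial data, solutions converge to zero uniformly. -/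
theorem RGASnu.exists_uniform_bound (h : RGASnu n l r D f) (R : ℝ) :
    ∃ ρ : ℝ → ℝ, AntitoneOn ρ (Ici 0) ∧ Tendsto ρ atTop (nhds 0) ∧ (∀ s, 0 ≤ s → 0 ≤ ρ s) ∧
      ∀ t x d φ τ, t ∈ Icc 0 R → ContinuousOn x (Icc (-r) 0) → histNorm n r x ≤ R →
        IsSolFrom n l r D f t x d φ → t ≤ τ →
          histNorm n r (fun θ => φ (τ + θ)) ≤ ρ (τ - t) := by
  obtain ⟨σ, β, hσ, hβ, -, hest⟩ := h
  obtain ⟨b, hb⟩ := isCompact_Icc.exists_bound_of_continuousOn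
    (hβ.1.mono (show Icc 0 R ⊆ Ici 0 from Icc_subset_Ici_self))
  have hnn : 0 ≤ |b| * |R| := by positivity
  refine ⟨σ (|b| * |R|), hσ.2.2.2.1 _ hnn, hσ.2.2.2.2 _ hnn, fun s hs => hσ.2.1 _ _ hnn hs, ?_⟩
  intro t x d φ τ ht hx hxR hφ hτ
  refine (hest t x d φ ht.1 hx hφ.1 hφ.2.1 hφ.2.2 τ hτ).trans ?_
  have hβ0 := (hβ.2 t ht.1).le
  refine (hσ.2.2.1 (τ - t) (by linarith)).1.monotoneOn
    (mul_nonneg hβ0 (histNorm_nonneg x)) hnn ?_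
  refine mul_le_mul ?_ (hxR.trans (le_abs_self R)) (histNorm_nonneg x) (abs_nonneg b)
  exact (le_abs_self _).trans ((hb t ht).trans (le_abs_self b))

theorem IsSolFrom.histNorm_sub_eq {t : ℝ} {x y : ℝ → Euc n} {d : ℝ → Euc l} {φ ψ : ℝ → Euc n}
    (hφ : IsSolFrom n l r D f t x d φ) (hψ : IsSolFrom n l r D f t y d ψ) :
    histNorm n r ((fun θ => φ (t + θ)) - fun θ => ψ (t + θ)) = histNorm n r (x - y) :=
  histNorm_congr fun θ hθ => by simp [hφ.2.2 θ hθ, hψ.2.2 θ hθ]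

theorem exists_lipschitz_deadZone (hr : 0 ≤ r) (h1 : H1 n l r D f) (h3 : H3 n l r D f)
    (h : RGASnu n l r D f) (q N : ℕ) :
    ∃ G, 0 ≤ G ∧ ∀ t x y d φ ψ τ, t ∈ Icc (0 : ℝ) N → ContinuousOn x (Icc (-r) 0) →
      ContinuousOn y (Icc (-r) 0) → histNorm n r x ≤ N → histNorm n r y ≤ N →
      IsSolFrom n l r D f t x d φ → IsSolFrom n l r D f t y d ψ → t ≤ τ →
        Real.exp (τ - t) * |max 0 (histNorm n r (fun θ => φ (τ + θ)) - 1 / ((q : ℝ) + 1)) -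
          max 0 (histNorm n r (fun θ => ψ (τ + θ)) - 1 / ((q : ℝ) + 1))| ≤
            G * histNorm n r (x - y) := by
  obtain ⟨ρ, hρa, hρ0, hρnn, hρ⟩ := h.exists_uniform_bound N
  obtain ⟨L, -, hL1, hL2, hLnn, hL⟩ := h1
  obtain ⟨T, hT⟩ := (eventually_atTop.1
    (hρ0.eventually_le_const (show (0 : ℝ) < 1 / ((q : ℝ) + 1) by positivity)))
  set S := |T| with hS
  have hS0 : 0 ≤ S := abs_nonneg T
  have hρ00 := hρnn 0 le_rfl
  set K := L (N + S) (ρ 0 + ρ 0) with hKdef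
  have hK : 0 ≤ K := hLnn _ _ (by positivity) (by positivity)
  refine ⟨Real.exp S * (2 * Real.exp ((4 * K + 4) * S)), by positivity, ?_⟩
  intro t x y d φ ψ τ ht hx hy hxN hyN hφ hψ hτ
  rcases le_total (τ - t) S with hτS | hτS
  · have hbound : ∀ s, t ≤ s → ∀ χ z, IsSolFrom n l r D f t z d χ →
        ContinuousOn z (Icc (-r) 0) → histNorm n r z ≤ N →
        histNorm n r (fun θ => χ (s + θ)) ≤ ρ 0 := fun s hs χ z hχ hz hzN =>
      (hρ t z d χ s ht hz hzN hχ hs).trans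
        (hρa self_mem_Ici (sub_nonneg.2 hs) (sub_nonneg.2 hs))
    have key := hφ.2.1.histNorm_sub_le h3 ht.1 hr hφ.1 hψ.2.1 (T := t + S) (by linarith) hK
      (fun s hs => by
        have hs0 : 0 ≤ s := ht.1.trans hs.1
        have e := hL s (fun θ => φ (s + θ)) (fun θ => ψ (s + θ)) (d s) hs0
          (continuousOn_hist hφ.2.1.1 hs.1) (continuousOn_hist hψ.2.1.1 hs.1) (hφ.1.1 s hs0)
        simp only [add_zero] at e
        refine e.trans (mul_le_mul_of_nonneg_right ?_ (sq_nonneg _))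
        have b1 := hbound s hs.1 φ x hφ hx hxN
        have b2 := hbound s hs.1 ψ y hψ hy hyN
        refine (hL1 s hs0 (add_nonneg (histNorm_nonneg _) (histNorm_nonneg _))
          (add_nonneg hρ00 hρ00) (add_le_add b1 b2)).trans ?_
        exact hL2 _ (add_nonneg hρ00 hρ00) hs0 (add_nonneg N.cast_nonneg hS0)
          (by linarith [hs.2, ht.2]))
      (τ := τ) ⟨hτ, by linarith⟩
    rw [hφ.histNorm_sub_eq hψ, add_sub_cancel_left] at key
    have h2 : |max 0 (histNorm n r (fun θ => φ (τ + θ)) - 1 / ((q : ℝ) + 1)) -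
          max 0 (histNorm n r (fun θ => ψ (τ + θ)) - 1 / ((q : ℝ) + 1))| ≤
        2 * Real.exp ((4 * K + 4) * S) * histNorm n r (x - y) := by
      refine (abs_max_sub_max_le_max _ _ _ _).trans (max_le ?_ ?_)
      · simpa using mul_nonneg (by positivity) (histNorm_nonneg (x - y))
      · rw [sub_sub_sub_cancel_right]
        exact (abs_histNorm_sub_le (continuousOn_hist hφ.2.1.1 hτ)
          (continuousOn_hist hψ.2.1.1 hτ)).trans key
    rw [mul_assoc]
    exact mul_le_mul (Real.exp_le_exp.2 hτS) h2 (abs_nonneg _) (Real.exp_pos _).le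
  · have hsmall := hT (τ - t) ((le_abs_self T).trans hτS)
    have e1 := (hρ t x d φ τ ht hx hxN hφ hτ).trans hsmall
    have e2 := (hρ t y d ψ τ ht hy hyN hψ hτ).trans hsmall
    rw [max_eq_left (by linarith), max_eq_left (by linarith), sub_self, abs_zero, mul_zero]
    exact mul_nonneg (by positivity) (histNorm_nonneg _)

/-- A `K∞` function of the history norm which, even after multiplication by `exp (τ - t)`,
depends on the initial history in a Lipschitz way uniformly on bounded sets. -/
theorem exists_isKInf_lipschitz (hr : 0 ≤ r) (h1 : H1 n l r D f) (h3 : H3 n l r D f)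
    (h : RGASnu n l r D f) :
    ∃ (a : ℝ → ℝ) (C : ℝ) (m : ℕ → ℝ), IsKInf a ∧ 0 ≤ C ∧ (∀ N, 0 ≤ m N) ∧
      (∀ s s', |a s - a s'| ≤ C * |s - s'|) ∧
      ∀ (N : ℕ) t x y d φ ψ τ, t ∈ Icc (0 : ℝ) N → ContinuousOn x (Icc (-r) 0) →
        ContinuousOn y (Icc (-r) 0) → histNorm n r x ≤ N → histNorm n r y ≤ N →
        IsSolFrom n l r D f t x d φ → IsSolFrom n l r D f t y d ψ → t ≤ τ →
          Real.exp (τ - t) * |a (histNorm n r (fun θ => φ (τ + θ))) -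
            a (histNorm n r (fun θ => ψ (τ + θ)))| ≤ m N * histNorm n r (x - y) := by
  choose G hG0 hG using exists_lipschitz_deadZone hr h1 h3 h
  obtain ⟨c, hc, hs, hcG⟩ := exists_summable_weights hG0
  refine ⟨deadZoneSum c, ∑' q, c q, fun N => ∑' q, c q * G q (max q N), isKInf_deadZoneSum hc hs,
    tsum_nonneg fun q => (hc q).le, fun N => tsum_nonneg fun q => mul_nonneg (hc q).le (hG0 _ _),
    abs_deadZoneSum_sub_le hc hs, ?_⟩
  intro N t x y d φ ψ τ ht hx hy hxN hyN hφ hψ hτ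
  refine mul_abs_deadZoneSum_sub_le hc hs (hcG N) (Real.exp_pos _).le fun q => ?_
  have hN : (N : ℝ) ≤ (max q N : ℕ) := by exact_mod_cast le_max_right q N
  exact hG q (max q N) t x y d φ ψ τ ⟨ht.1, ht.2.trans hN⟩ hx hy (hxN.trans hN) (hyN.trans hN)
    hφ hψ hτ

end Constants

section Gauge

/-- For a countable set of times there is a bounded non-increasing continuous gauge whose right
derivative is `-∞` at each of these times. -/
theorem exists_gauge {A : Set ℝ} (hA : (A ∩ Ici 0).Countable) :
    ∃ γ : ℝ → ℝ, Continuous γ ∧ Antitone γ ∧ (∀ t, 1 ≤ γ t) ∧ (∀ t, γ t ≤ 3) ∧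
      ∀ t ∈ A, 0 ≤ t → ∃ κ > 0, ∀ h ∈ Ioo (0 : ℝ) 1, γ (t + h) ≤ γ t - κ * √h := by
  obtain ⟨e, he⟩ := (hA.insert 0).exists_eq_range (insert_nonempty _ _)
  set ψ : ℝ → ℝ := fun s => 1 - √(min (max s 0) 1) with hψ
  have hψc : Continuous ψ := by fun_prop
  have hψa : Antitone ψ := fun s s' h =>
    sub_le_sub_left (Real.sqrt_le_sqrt (min_le_min_right _ (max_le_max_right _ h))) _
  have hψ0 : ∀ s, 0 ≤ ψ s := fun s =>
    sub_nonneg.2 (Real.sqrt_le_one.2 (min_le_right _ _))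
  have hψ1 : ∀ s, ψ s ≤ 1 := fun s => sub_le_self _ (Real.sqrt_nonneg _)
  have hgeo : Summable fun k : ℕ => ((1 : ℝ) / 2) ^ k := summable_geometric_two
  have hle : ∀ t (k : ℕ), ((1 : ℝ) / 2) ^ k * ψ (t - e k) ≤ (1 / 2) ^ k := fun t k =>
    mul_le_of_le_one_right (by positivity) (hψ1 _)
  have hnn : ∀ t (k : ℕ), 0 ≤ ((1 : ℝ) / 2) ^ k * ψ (t - e k) := fun t k =>
    mul_nonneg (by positivity) (hψ0 _)
  have hsum : ∀ t, Summable fun k : ℕ => ((1 : ℝ) / 2) ^ k * ψ (t - e k) := fun t =>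
    hgeo.of_nonneg_of_le (hnn t) (hle t)
  have hanti : ∀ s t, s ≤ t → ∀ k : ℕ,
      ((1 : ℝ) / 2) ^ k * ψ (t - e k) ≤ (1 / 2) ^ k * ψ (s - e k) := fun s t hst k =>
    mul_le_mul_of_nonneg_left (hψa (by linarith)) (by positivity)
  refine ⟨fun t => 1 + ∑' k : ℕ, (1 / 2) ^ k * ψ (t - e k), ?_, fun s t hst => ?_, fun t => ?_,
    fun t => ?_, fun t htA ht => ?_⟩
  · refine continuous_const.add (continuous_tsum (fun k => by fun_prop) hgeo fun k t => ?_)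
    rw [Real.norm_of_nonneg (hnn t k)]
    exact hle t k
  · exact add_le_add_right ((hsum t).tsum_le_tsum (hanti s t hst) (hsum s)) 1
  · exact le_add_of_nonneg_right (tsum_nonneg (hnn t))
  · have := (hsum t).tsum_le_tsum (hle t) hgeo
    rw [tsum_geometric_two] at this
    linarith
  · obtain ⟨k, rfl⟩ : t ∈ range e := he ▸ mem_insert_of_mem _ ⟨htA, ht⟩
    refine ⟨(1 / 2) ^ k, by positivity, fun h hh => ?_⟩
    have hd := ((hsum (e k)).sub (hsum (e k + h))).le_tsum k fun j _ =>
      sub_nonneg.2 (hanti _ _ (by linarith [hh.1]) j)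
    rw [(hsum (e k)).tsum_sub (hsum (e k + h))] at hd
    have h1 : ψ (e k - e k) = 1 := by simp [hψ]
    have h2 : ψ (e k + h - e k) = 1 - √h := by
      simp [hψ, max_eq_left hh.1.le, min_eq_left hh.2.le]
    rw [h1, h2] at hd
    linarith

theorem Monotone.exists_continuous_majorant {M : ℝ → ℝ} (hM : Monotone M) :
    ∃ b : ℝ → ℝ, Continuous b ∧ Monotone b ∧ ∀ s, M s ≤ b s := by
  have hI : ∀ u v, IntervalIntegrable M volume u v := fun u v => hM.intervalIntegrable
  have hIs : ∀ s u v, IntervalIntegrable (fun w => M (s + w)) volume u v := fun s u v =>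
    (hM.comp (monotone_id.const_add s)).intervalIntegrable
  have hshift : ∀ s, ∫ u in (0 : ℝ)..1, M (s + u) = ∫ u in s..s + 1, M u := fun s => by
    rw [intervalIntegral.integral_comp_add_left, add_zero]
  refine ⟨fun s => ∫ u in (0 : ℝ)..1, M (s + u), ?_, fun s t hst => ?_, fun s => ?_⟩
  · have hF := intervalIntegral.continuous_primitive hI 0
    refine ((hF.comp (continuous_add_const 1)).sub hF).congr fun s => ?_
    rw [hshift s]
    exact intervalIntegral.integral_interval_sub_left (hI _ _) (hI _ _)
  · exact intervalIntegral.integral_mono_on zero_le_one (hIs s _ _) (hIs t _ _) fun u _ =>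
      hM (by linarith)
  · have := intervalIntegral.integral_mono_on (f := fun _ => M s) zero_le_one
      intervalIntegrable_const (hIs s 0 1) fun u hu => hM (by linarith [hu.1])
    simpa using this

end Gauge

section Functional

variable {n l : ℕ} {r : ℝ} {D : Set (Euc l)} {f : ℝ → (ℝ → Euc n) → Euc l → Euc n}

theorem IsSolGlobal.norm_sub_smul_le {d : ℝ → Euc l} {t₀ s ε : ℝ} {φ : ℝ → Euc n} {v : Euc n}
    (hφ : IsSolGlobal n l r f d t₀ φ) (hs : t₀ ≤ s)
    (h : ∀ u ∈ Icc t₀ s, ‖f u (fun θ => φ (u + θ)) (d u) - v‖ ≤ ε) :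
    ‖φ s - (φ t₀ + (s - t₀) • v)‖ ≤ ε * (s - t₀) := by
  obtain ⟨i, e⟩ := hφ.2 s hs
  have h1 : φ s - (φ t₀ + (s - t₀) • v) =
      ∫ u in t₀..s, (f u (fun θ => φ (u + θ)) (d u) - v) := by
    rw [intervalIntegral.integral_sub i intervalIntegrable_const, intervalIntegral.integral_const,
      e]
    abel
  rw [h1, ← abs_of_nonneg (sub_nonneg.2 hs)]
  refine intervalIntegral.norm_integral_le_of_norm_le_const fun u hu => ?_
  rw [uIoc_of_le hs] at hu
  exact h u (Ioc_subset_Icc_self hu)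

theorem IsSolFrom.restart {t s : ℝ} {x : ℝ → Euc n} {d : ℝ → Euc l} {φ : ℝ → Euc n}
    (hφ : IsSolFrom n l r D f t x d φ) (hs : t ≤ s) :
    IsSolFrom n l r D f s (fun θ => φ (s + θ)) d φ :=
  ⟨hφ.1, hφ.2.1.restart hs, fun _ _ => rfl⟩

theorem exists_bound_rhs (h2 : H2 n l r D f) (h : RGASnu n l r D f) (R T : ℝ) :
    ∃ C, 0 < C ∧ ∀ t x d φ s, t ∈ Icc 0 R → ContinuousOn x (Icc (-r) 0) → histNorm n r x ≤ R →
      IsSolFrom n l r D f t x d φ → t ≤ s → s ≤ T → ‖f s (fun θ => φ (s + θ)) (d s)‖ ≤ C := by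
  obtain ⟨ρ, hρa, -, -, hρ⟩ := h.exists_uniform_bound R
  obtain ⟨C, hC⟩ := h2 T (ρ 0)
  refine ⟨|C| + 1, by positivity, fun t x d φ s ht hx hxR hφ hs hsT => ?_⟩
  have hs0 : 0 ≤ s := ht.1.trans hs
  have := hC s _ (d s) hs0 hsT (continuousOn_hist hφ.2.1.1 hs)
    ((hρ t x d φ s ht hx hxR hφ hs).trans
      (hρa self_mem_Ici (sub_nonneg.2 hs) (sub_nonneg.2 hs))) (hφ.1.1 s hs0)
  linarith [le_abs_self C]

/-- Solutions leave their initial history at a speed that is uniform in the initial time and in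
the disturbance. -/
theorem exists_histNorm_hist_sub_init_lt (hr : 0 ≤ r) (h2 : H2 n l r D f) (h : RGASnu n l r D f)
    (R : ℝ) {x : ℝ → Euc n} (hx : ContinuousOn x (Icc (-r) 0)) {ε : ℝ} (hε : 0 < ε) :
    ∃ δ > 0, ∀ t d φ τ, t ∈ Icc 0 R → τ ≤ R → IsSolFrom n l r D f t x d φ → t ≤ τ → τ < t + δ →
      histNorm n r ((fun θ => φ (τ + θ)) - x) < ε := by
  obtain ⟨C, hC, hCb⟩ := exists_bound_rhs h2 h (max R (histNorm n r x)) R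
  obtain ⟨δ, hδ, huc⟩ := Metric.uniformContinuousOn_iff.1
    (isCompact_Icc.uniformContinuousOn_of_continuous hx) (ε / 4) (by positivity)
  refine ⟨min δ (ε / (4 * C)), by positivity, fun t d φ τ ht hτR hφ hτ hτδ => ?_⟩
  have hτδ₁ : τ - t < δ := by linarith [min_le_left δ (ε / (4 * C))]
  have hτδ₂ : C * (τ - t) ≤ ε / 4 := by
    have : τ - t ≤ ε / (4 * C) := by linarith [min_le_right δ (ε / (4 * C))]
    rw [le_div_iff₀ (by positivity)] at this
    linarith
  refine (histNorm_le (C := ε / 2) (by positivity) fun θ hθ => ?_).trans_lt (half_lt_self hε)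
  change ‖φ (τ + θ) - x θ‖ ≤ ε / 2
  rcases le_total (τ + θ) t with hle | hle
  · have hmem : τ + θ - t ∈ Icc (-r) 0 := ⟨by linarith [hθ.1], by linarith⟩
    have e1 := hφ.2.2 _ hmem
    rw [add_sub_cancel] at e1
    have e2 := huc _ hmem θ hθ (by
      rw [Real.dist_eq, abs_lt]
      constructor <;> linarith)
    rw [e1, ← dist_eq_norm]
    linarith
  · have e1 := hφ.2.1.norm_sub_smul_le (s := τ + θ) (v := 0) (ε := C) hle fun u hu => by
      rw [sub_zero]
      exact hCb t x d φ u ⟨ht.1, ht.2.trans (le_max_left _ _)⟩ hx (le_max_right _ _) hφ hu.1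
        (by linarith [hu.2, hθ.2])
    have e2 := hφ.2.2 0 ⟨by linarith, le_rfl⟩
    rw [add_zero] at e2
    rw [smul_zero, add_zero, e2] at e1
    have e3 := huc 0 ⟨by linarith, le_rfl⟩ θ hθ (by
      rw [Real.dist_eq, abs_lt]
      constructor <;> linarith [hθ.2])
    rw [dist_eq_norm] at e3
    have e4 : C * (τ + θ - t) ≤ C * (τ - t) :=
      mul_le_mul_of_nonneg_left (by linarith [hθ.2]) hC.le
    have e5 := norm_add_le (φ (τ + θ) - x 0) (x 0 - x θ)
    rw [sub_add_sub_cancel] at e5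
    linarith

/-- The values `exp (τ - t) * a ‖T_r(τ) φ‖_r` along all solutions `φ` issued from `(t, x)`. -/
def lyapValues (n l : ℕ) (r : ℝ) (D : Set (Euc l)) (f : ℝ → (ℝ → Euc n) → Euc l → Euc n)
    (a : ℝ → ℝ) (t : ℝ) (x : ℝ → Euc n) : Set ℝ :=
  {v | ∃ d φ τ, IsSolFrom n l r D f t x d φ ∧ t ≤ τ ∧
    v = Real.exp (τ - t) * a (histNorm n r fun θ => φ (τ + θ))}

/-- The supremum of `exp (τ - t) * a ‖T_r(τ) φ‖_r` over all solutions `φ` issued from `(t, x)`. -/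
def lyapSup (n l : ℕ) (r : ℝ) (D : Set (Euc l)) (f : ℝ → (ℝ → Euc n) → Euc l → Euc n)
    (a : ℝ → ℝ) (t : ℝ) (x : ℝ → Euc n) : ℝ :=
  sSup (lyapValues n l r D f a t x)

/-- Exponentially weighted values of `a` depend on the initial history in a Lipschitz way,
with constant `m N` on the `N`-th bounded set. -/
def ExpLipschitz (n l : ℕ) (r : ℝ) (D : Set (Euc l)) (f : ℝ → (ℝ → Euc n) → Euc l → Euc n)
    (a : ℝ → ℝ) (m : ℕ → ℝ) : Prop :=
  ∀ (N : ℕ) t x y d φ ψ τ, t ∈ Icc (0 : ℝ) N → ContinuousOn x (Icc (-r) 0) →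
    ContinuousOn y (Icc (-r) 0) → histNorm n r x ≤ N → histNorm n r y ≤ N →
    IsSolFrom n l r D f t x d φ → IsSolFrom n l r D f t y d ψ → t ≤ τ →
      Real.exp (τ - t) * |a (histNorm n r (fun θ => φ (τ + θ))) -
        a (histNorm n r (fun θ => ψ (τ + θ)))| ≤ m N * histNorm n r (x - y)

variable {a : ℝ → ℝ} {m : ℕ → ℝ} {t : ℝ} {x y : ℝ → Euc n} {N : ℕ}

theorem lyapValues_nonempty (hD : D.Nonempty) (h : RGASnu n l r D f) (ht : 0 ≤ t)
    (hx : ContinuousOn x (Icc (-r) 0)) : (lyapValues n l r D f a t x).Nonempty := by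
  obtain ⟨d, hd⟩ := hD
  obtain ⟨φ, hφ⟩ := h.exists_isSolFrom ht hx (MD.const hd)
  exact ⟨_, _, φ, t, hφ, le_rfl, rfl⟩

theorem le_of_mem_lyapValues (h : RGASnu n l r D f) (ha : IsKInf a)
    (hlip : ExpLipschitz n l r D f a m) (ht : t ∈ Icc (0 : ℝ) N)
    (hx : ContinuousOn x (Icc (-r) 0)) (hxN : histNorm n r x ≤ N) {v : ℝ}
    (hv : v ∈ lyapValues n l r D f a t x) : v ≤ m N * histNorm n r x := by
  obtain ⟨d, φ, τ, hφ, hτ, rfl⟩ := hv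
  have h0 : histNorm n r (fun _ => (0 : Euc n)) = 0 :=
    le_antisymm (histNorm_le le_rfl fun θ _ => by simp) (histNorm_nonneg _)
  obtain ⟨ψ, hψ⟩ := h.exists_isSolFrom (x := fun _ => 0) ht.1 continuousOn_const hφ.1
  have e := hlip N t x (fun _ => 0) d φ ψ τ ht hx continuousOn_const hxN
    (h0.trans_le N.cast_nonneg) hφ hψ hτ
  rw [h.histNorm_eq_zero ht.1 continuousOn_const hψ h0 hτ, ha.2.2.1, sub_zero] at e
  have e0 : x - (fun _ => (0 : Euc n)) = x := sub_zero x
  rw [e0] at e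
  exact (mul_le_mul_of_nonneg_left (le_abs_self _) (Real.exp_pos _).le).trans e

theorem le_lyapSup (h : RGASnu n l r D f) (ha : IsKInf a) (hlip : ExpLipschitz n l r D f a m)
    (ht : 0 ≤ t) (hx : ContinuousOn x (Icc (-r) 0)) {v : ℝ}
    (hv : v ∈ lyapValues n l r D f a t x) : v ≤ lyapSup n l r D f a t x := by
  obtain ⟨N, hN⟩ := exists_nat_ge (max t (histNorm n r x))
  exact le_csSup ⟨_, fun w hw => le_of_mem_lyapValues h ha hlip
    ⟨ht, (le_max_left _ _).trans hN⟩ hx ((le_max_right _ _).trans hN) hw⟩ hv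

theorem lyapSup_le (hD : D.Nonempty) (h : RGASnu n l r D f) (ha : IsKInf a)
    (hlip : ExpLipschitz n l r D f a m) (ht : t ∈ Icc (0 : ℝ) N)
    (hx : ContinuousOn x (Icc (-r) 0)) (hxN : histNorm n r x ≤ N) :
    lyapSup n l r D f a t x ≤ m N * histNorm n r x :=
  csSup_le (lyapValues_nonempty hD h ht.1 hx) fun _ hv => le_of_mem_lyapValues h ha hlip ht hx hxN hv

theorem apply_histNorm_le_lyapSup (hD : D.Nonempty) (h : RGASnu n l r D f) (ha : IsKInf a)
    (hlip : ExpLipschitz n l r D f a m) (ht : 0 ≤ t) (hx : ContinuousOn x (Icc (-r) 0)) :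
    a (histNorm n r x) ≤ lyapSup n l r D f a t x := by
  obtain ⟨d, hd⟩ := hD
  obtain ⟨φ, hφ⟩ := h.exists_isSolFrom ht hx (MD.const hd)
  refine le_lyapSup h ha hlip ht hx ⟨_, φ, t, hφ, le_rfl, ?_⟩
  rw [sub_self, Real.exp_zero, one_mul, histNorm_congr hφ.2.2]

theorem lyapSup_nonneg (hD : D.Nonempty) (h : RGASnu n l r D f) (ha : IsKInf a)
    (hlip : ExpLipschitz n l r D f a m) (ht : 0 ≤ t) (hx : ContinuousOn x (Icc (-r) 0)) :
    0 ≤ lyapSup n l r D f a t x :=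
  (ha.2.2.2.1 _ (histNorm_nonneg x)).trans (apply_histNorm_le_lyapSup hD h ha hlip ht hx)

theorem lyapSup_le_add (hD : D.Nonempty) (h : RGASnu n l r D f) (ha : IsKInf a)
    (hlip : ExpLipschitz n l r D f a m) (ht : t ∈ Icc (0 : ℝ) N)
    (hx : ContinuousOn x (Icc (-r) 0)) (hy : ContinuousOn y (Icc (-r) 0))
    (hxN : histNorm n r x ≤ N) (hyN : histNorm n r y ≤ N) :
    lyapSup n l r D f a t x ≤ lyapSup n l r D f a t y + m N * histNorm n r (x - y) := by
  refine csSup_le (lyapValues_nonempty hD h ht.1 hx) ?_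
  rintro _ ⟨d, φ, τ, hφ, hτ, rfl⟩
  obtain ⟨ψ, hψ⟩ := h.exists_isSolFrom ht.1 hy hφ.1
  have e1 := hlip N t x y d φ ψ τ ht hx hy hxN hyN hφ hψ hτ
  have e2 := le_lyapSup h ha hlip ht.1 hy ⟨d, ψ, τ, hψ, hτ, rfl⟩
  have e3 := mul_le_mul_of_nonneg_left (le_abs_self (a (histNorm n r (fun θ => φ (τ + θ))) -
        a (histNorm n r (fun θ => ψ (τ + θ))))) (Real.exp_pos (τ - t)).le
  rw [mul_sub] at e3
  linarith

theorem abs_lyapSup_sub_le (hD : D.Nonempty) (h : RGASnu n l r D f) (ha : IsKInf a)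
    (hlip : ExpLipschitz n l r D f a m) (ht : t ∈ Icc (0 : ℝ) N)
    (hx : ContinuousOn x (Icc (-r) 0)) (hy : ContinuousOn y (Icc (-r) 0))
    (hxN : histNorm n r x ≤ N) (hyN : histNorm n r y ≤ N) :
    |lyapSup n l r D f a t x - lyapSup n l r D f a t y| ≤ m N * histNorm n r (x - y) := by
  have e1 := lyapSup_le_add hD h ha hlip ht hx hy hxN hyN
  have e2 := lyapSup_le_add hD h ha hlip ht hy hx hyN hxN
  rw [histNorm_sub_comm y x] at e2
  rw [abs_le]
  constructor <;> linarith

/-- Exponential decay of the functional along solutions. -/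
theorem lyapSup_hist_le (hr : 0 ≤ r) (hD : D.Nonempty) (h3 : H3 n l r D f) (h : RGASnu n l r D f)
    (ha : IsKInf a) (hlip : ExpLipschitz n l r D f a m) (ht : 0 ≤ t)
    (hx : ContinuousOn x (Icc (-r) 0)) {d : ℝ → Euc l} {φ : ℝ → Euc n}
    (hφ : IsSolFrom n l r D f t x d φ) {s : ℝ} (hs : t ≤ s) :
    lyapSup n l r D f a s (fun θ => φ (s + θ)) ≤
      Real.exp (-(s - t)) * lyapSup n l r D f a t x := by
  refine csSup_le (lyapValues_nonempty hD h (ht.trans hs) (continuousOn_hist hφ.2.1.1 hs)) ?_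
  rintro _ ⟨d', ψ, τ, hψ, hτ, rfl⟩
  have hsol : IsSolFrom n l r D f t x (fun u => if u < s then d u else d' u)
      (fun u => if u < s then φ u else ψ u) := by
    refine ⟨hφ.1.concat hψ.1 s,
      hφ.2.1.concat h3 hr ht hs hφ.1 hψ.1 hψ.2.1 hψ.2.2, fun θ hθ => ?_⟩
    rw [← hφ.2.2 θ hθ]
    dsimp only
    split_ifs with hlt
    · rfl
    · have : t + θ = s + 0 := by linarith [hθ.2, not_lt.1 hlt]
      rw [this]
      exact hψ.2.2 0 ⟨by linarith, le_rfl⟩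
  have e1 := le_lyapSup h ha hlip ht hx ⟨_, _, τ, hsol, hs.trans hτ, rfl⟩
  have e2 : histNorm n r (fun θ => if τ + θ < s then φ (τ + θ) else ψ (τ + θ)) =
      histNorm n r (fun θ => ψ (τ + θ)) := by
    refine histNorm_congr fun θ hθ => ?_
    split_ifs with hlt
    · have := hψ.2.2 (τ + θ - s) ⟨by linarith [hθ.1], by linarith⟩
      simp only [add_sub_cancel] at this
      exact this.symm
    · rfl
  rw [e2] at e1
  have e3 : Real.exp (τ - s) = Real.exp (-(s - t)) * Real.exp (τ - t) := by
    rw [← Real.exp_add]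
    congr 1
    ring
  rw [e3, mul_assoc]
  exact mul_le_mul_of_nonneg_left e1 (Real.exp_pos _).le

/-- Comparison of the functional at two times, in terms of the displacement of solutions between
these times. -/
theorem abs_lyapSup_sub_le_of_hist (hr : 0 ≤ r) (hD : D.Nonempty) (h3 : H3 n l r D f)
    (h : RGASnu n l r D f) (ha : IsKInf a) {C : ℝ} (hC : 0 ≤ C)
    (haC : ∀ s s', |a s - a s'| ≤ C * |s - s'|) (hm : ∀ N, 0 ≤ m N)
    (hlip : ExpLipschitz n l r D f a m) {t₁ t₂ η : ℝ} (ht₁ : 0 ≤ t₁) (ht : t₁ ≤ t₂)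
    (ht₂ : t₂ ≤ N) (hlen : t₂ - t₁ ≤ 1) (hx : ContinuousOn x (Icc (-r) 0))
    (hxN : histNorm n r x + 1 ≤ N) (hη₁ : η ≤ 1)
    (hη : ∀ d φ τ, IsSolFrom n l r D f t₁ x d φ → t₁ ≤ τ → τ ≤ t₂ →
      histNorm n r ((fun θ => φ (τ + θ)) - x) ≤ η) :
    |lyapSup n l r D f a t₂ x - lyapSup n l r D f a t₁ x| ≤
      2 * (t₂ - t₁) * (m N * histNorm n r x) + 3 * ((m N + C) * η) := by
  have ht₂' : t₂ ∈ Icc (0 : ℝ) N := ⟨ht₁.trans ht, ht₂⟩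
  have hxN' : histNorm n r x ≤ N := by linarith
  have hexp := Real.abs_exp_sub_one_le (x := t₂ - t₁) (by rwa [abs_of_nonneg (by linarith)])
  rw [abs_of_nonneg (show 0 ≤ t₂ - t₁ by linarith)] at hexp
  have hexp' := (le_abs_self _).trans hexp
  have hmem : ∀ d φ τ, IsSolFrom n l r D f t₁ x d φ → t₁ ≤ τ → τ ≤ t₂ →
      histNorm n r (fun θ => φ (τ + θ)) ≤ N := fun d φ τ hφ h1 h2 => by
    have e1 := histNorm_le_add (continuousOn_hist hφ.2.1.1 h1) hx
    have e2 := hη d φ τ hφ h1 h2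
    linarith
  have hη₀ : 0 ≤ η := by
    obtain ⟨d, hd⟩ := hD
    obtain ⟨φ, hφ⟩ := h.exists_isSolFrom ht₁ hx (MD.const hd)
    exact (histNorm_nonneg _).trans (hη _ φ t₁ hφ le_rfl ht)
  have hW₂ := lyapSup_le hD h ha hlip ht₂' hx hxN'
  have hW₂0 := lyapSup_nonneg hD h ha hlip ht₂'.1 hx
  have hW₁0 := lyapSup_nonneg hD h ha hlip ht₁ hx
  have hmη := mul_nonneg (hm N) hη₀
  have hCη := mul_nonneg hC hη₀
  have hQ : 0 ≤ m N * histNorm n r x := mul_nonneg (hm N) (histNorm_nonneg x)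
  have up : lyapSup n l r D f a t₂ x ≤ lyapSup n l r D f a t₁ x + m N * η := by
    obtain ⟨d, hd⟩ := hD
    obtain ⟨φ, hφ⟩ := h.exists_isSolFrom ht₁ hx (MD.const hd)
    have e1 := lyapSup_le_add ⟨d, hd⟩ h ha hlip ht₂' hx (continuousOn_hist hφ.2.1.1 ht) hxN'
      (hmem _ φ t₂ hφ ht le_rfl)
    rw [histNorm_sub_comm] at e1
    have e2 := mul_le_mul_of_nonneg_left (hη _ φ t₂ hφ ht le_rfl) (hm N)
    have e3 := lyapSup_hist_le hr ⟨d, hd⟩ h3 h ha hlip ht₁ hx hφ ht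
    have e4 : Real.exp (-(t₂ - t₁)) * lyapSup n l r D f a t₁ x ≤ lyapSup n l r D f a t₁ x :=
      mul_le_of_le_one_left hW₁0 (Real.exp_le_one_iff.2 (by linarith))
    linarith
  have down : lyapSup n l r D f a t₁ x ≤
      Real.exp (t₂ - t₁) * (lyapSup n l r D f a t₂ x + (m N + C) * η) := by
    refine csSup_le (lyapValues_nonempty hD h ht₁ hx) ?_
    rintro _ ⟨d, φ, τ, hφ, hτ, rfl⟩
    rcases le_total t₂ τ with h2 | h2
    · have hcont := continuousOn_hist hφ.2.1.1 ht
      have e1 := le_lyapSup h ha hlip ht₂'.1 hcont ⟨d, φ, τ, hφ.restart ht, h2, rfl⟩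
      have e2 := lyapSup_le_add hD h ha hlip ht₂' hcont hx (hmem d φ t₂ hφ ht le_rfl) hxN'
      have e3 := mul_le_mul_of_nonneg_left (hη d φ t₂ hφ ht le_rfl) (hm N)
      have e4 : Real.exp (τ - t₁) = Real.exp (t₂ - t₁) * Real.exp (τ - t₂) := by
        rw [← Real.exp_add]
        congr 1
        ring
      rw [e4, mul_assoc]
      exact mul_le_mul_of_nonneg_left (by linarith) (Real.exp_pos _).le
    · have e1 := haC (histNorm n r fun θ => φ (τ + θ)) (histNorm n r x)
      have e2 := abs_histNorm_sub_le (continuousOn_hist hφ.2.1.1 hτ) hx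
      have e3 := mul_le_mul_of_nonneg_left (e2.trans (hη d φ τ hφ hτ h2)) hC
      have e4 := apply_histNorm_le_lyapSup hD h ha hlip ht₂'.1 hx
      have e5 := le_abs_self (a (histNorm n r fun θ => φ (τ + θ)) - a (histNorm n r x))
      refine mul_le_mul (Real.exp_le_exp.2 (by linarith)) (by linarith)
        (ha.2.2.2.1 _ (histNorm_nonneg _)) (Real.exp_pos _).le
  have e1 : (Real.exp (t₂ - t₁) - 1) * lyapSup n l r D f a t₂ x ≤
      2 * (t₂ - t₁) * (m N * histNorm n r x) :=
    mul_le_mul hexp' hW₂ hW₂0 (by linarith)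
  have e2 : Real.exp (t₂ - t₁) * ((m N + C) * η) ≤ 3 * ((m N + C) * η) :=
    mul_le_mul_of_nonneg_right (by linarith) (mul_nonneg (add_nonneg (hm N) hC) hη₀)
  have e3 : 0 ≤ 2 * (t₂ - t₁) * (m N * histNorm n r x) :=
    mul_nonneg (by linarith) hQ
  rw [abs_le]
  constructor <;> nlinarith

theorem exists_abs_lyapSup_sub_lt (hr : 0 ≤ r) (hD : D.Nonempty) (h2 : H2 n l r D f)
    (h3 : H3 n l r D f) (h : RGASnu n l r D f) (ha : IsKInf a) {C : ℝ} (hC : 0 ≤ C)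
    (haC : ∀ s s', |a s - a s'| ≤ C * |s - s'|) (hm : ∀ N, 0 ≤ m N)
    (hlip : ExpLipschitz n l r D f a m) (ht : 0 ≤ t) (hx : ContinuousOn x (Icc (-r) 0))
    {ε : ℝ} (hε : 0 < ε) :
    ∃ δ > 0, ∀ t', 0 ≤ t' → |t' - t| < δ →
      |lyapSup n l r D f a t' x - lyapSup n l r D f a t x| < ε := by
  obtain ⟨N, hN⟩ := exists_nat_ge (max (t + 1) (histNorm n r x + 1))
  have htN : t + 1 ≤ N := (le_max_left _ _).trans hN
  have hxN : histNorm n r x + 1 ≤ N := (le_max_right _ _).trans hN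
  have hmC : 0 ≤ m N + C := add_nonneg (hm N) hC
  have hQ : 0 ≤ m N * histNorm n r x := mul_nonneg (hm N) (histNorm_nonneg x)
  set η := min 1 (ε / (6 * (m N + C + 1))) with hη
  have hη0 : 0 < η := by positivity
  have hη2 : (m N + C) * η < ε / 6 := by
    have : η ≤ ε / (6 * (m N + C + 1)) := min_le_right _ _
    rw [le_div_iff₀ (by positivity)] at this
    nlinarith
  obtain ⟨δ, hδ, hmod⟩ := exists_histNorm_hist_sub_init_lt hr h2 h (N : ℝ) hx hη0
  set δ' := ε / (4 * (m N * histNorm n r x + 1)) with hδ'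
  have hδ'0 : 0 < δ' := by positivity
  have hδ'2 : δ' * (m N * histNorm n r x) ≤ ε / 4 := by
    have : δ' * (4 * (m N * histNorm n r x + 1)) = ε := by
      rw [hδ']
      field_simp
    nlinarith
  have key : ∀ t₁ t₂ : ℝ, 0 ≤ t₁ → t₁ ≤ t₂ → t₂ ≤ N → t₂ - t₁ < min δ (min 1 δ') →
      |lyapSup n l r D f a t₂ x - lyapSup n l r D f a t₁ x| < ε := by
    intro t₁ t₂ h0 h12 hN2 hlen
    simp only [lt_min_iff] at hlen
    have e := abs_lyapSup_sub_le_of_hist hr hD h3 h ha hC haC hm hlip h0 h12 hN2 hlen.2.1.le hx hxN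
      (min_le_left 1 (ε / (6 * (m N + C + 1)))) fun d φ τ hφ h1 h2 =>
        (hmod t₁ d φ τ ⟨h0, h12.trans hN2⟩ (h2.trans hN2) hφ h1 (by linarith)).le
    have e2 : (t₂ - t₁) * (m N * histNorm n r x) ≤ δ' * (m N * histNorm n r x) :=
      mul_le_mul_of_nonneg_right hlen.2.2.le hQ
    rw [← hη] at e
    linarith
  refine ⟨min δ (min 1 δ'), by positivity, fun t' ht' htt' => ?_⟩
  have h1 : |t' - t| < 1 := htt'.trans_le ((min_le_right _ _).trans (min_le_left _ _))
  rcases le_total t t' with hle | hle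
  · rw [abs_of_nonneg (sub_nonneg.2 hle)] at htt' h1
    exact key t t' ht hle (by linarith) htt'
  · rw [abs_sub_comm, abs_of_nonneg (sub_nonneg.2 hle)] at htt'
    rw [abs_sub_comm]
    exact key t' t ht' hle (by linarith) htt'

end Functional

section Derivative

variable {n l : ℕ} {r : ℝ} {D : Set (Euc l)} {f : ℝ → (ℝ → Euc n) → Euc l → Euc n}
  {a : ℝ → ℝ} {m : ℕ → ℝ} {t : ℝ} {x : ℝ → Euc n}

theorem continuousOn_Eop (hr : 0 ≤ r) (hx : ContinuousOn x (Icc (-r) 0)) {h : ℝ} (hh : 0 ≤ h)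
    (v : Euc n) : ContinuousOn (Eop n x h v) (Icc (-r) 0) := by
  have e : Eop n x h v = fun θ => x (min (θ + h) 0) + max (θ + h) 0 • v := by
    funext θ
    unfold Eop
    split_ifs with hθ
    · rw [min_eq_right (by linarith), max_eq_left (by linarith)]
    · rw [min_eq_left (by linarith), max_eq_right (by linarith), zero_smul, add_zero]
  rw [e]
  refine (hx.comp (by fun_prop) fun θ hθ => ?_).add (by fun_prop)
  exact ⟨le_min (by linarith [hθ.1]) (by linarith), min_le_right _ _⟩

theorem IsSolFrom.histNorm_Eop_sub_le (hr : 0 ≤ r) {d : ℝ → Euc l} {φ : ℝ → Euc n}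
    (hφ : IsSolFrom n l r D f t x d φ) {h ε : ℝ} (hh : 0 ≤ h) (hε : 0 ≤ ε) {v : Euc n}
    (hv : ∀ u ∈ Icc t (t + h), ‖f u (fun θ => φ (u + θ)) (d u) - v‖ ≤ ε) {y : ℝ → Euc n}
    (hy : ContinuousOn y (Icc (-r) 0)) :
    histNorm n r ((fun θ => Eop n x h v θ + h • y θ) - fun θ => φ (t + h + θ)) ≤
      h * (ε + histNorm n r y) := by
  refine histNorm_le (mul_nonneg hh (add_nonneg hε (histNorm_nonneg y))) fun θ hθ => ?_
  have hyθ : ‖h • y θ‖ ≤ h * histNorm n r y := by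
    rw [norm_smul, Real.norm_of_nonneg hh]
    exact mul_le_mul_of_nonneg_left (norm_le_histNorm hy hθ) hh
  have hE : ‖Eop n x h v θ - φ (t + h + θ)‖ ≤ h * ε := by
    unfold Eop
    split_ifs with hlt
    · have e1 := hφ.2.1.norm_sub_smul_le (s := t + h + θ) (v := v) (ε := ε) (by linarith)
        fun u hu => hv u ⟨hu.1, by linarith [hu.2, hθ.2]⟩
      have e2 := hφ.2.2 0 ⟨by linarith, le_rfl⟩
      rw [add_zero] at e2
      rw [e2, norm_sub_rev, show t + h + θ - t = θ + h by ring] at e1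
      exact e1.trans (by nlinarith [hθ.2])
    · have e := hφ.2.2 (θ + h) ⟨by linarith [hθ.1], by linarith⟩
      rw [← e, show t + (θ + h) = t + h + θ by ring, sub_self, norm_zero]
      positivity
  have e : ((fun θ => Eop n x h v θ + h • y θ) - fun θ => φ (t + h + θ)) θ =
      (Eop n x h v θ - φ (t + h + θ)) + h • y θ := by
    simp only [Pi.sub_apply]
    abel
  rw [e, mul_add]
  exact (norm_add_le _ _).trans (add_le_add hE hyθ)

/-- Growth of the functional along the affine extrapolation of a history, compared with a solution
whose velocity stays within distance `ε` of `v`. -/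
theorem exists_lyapSup_Eop_le (hr : 0 ≤ r) (hD : D.Nonempty) (h3 : H3 n l r D f)
    (h : RGASnu n l r D f) (ha : IsKInf a) (hm : ∀ N, 0 ≤ m N)
    (hlip : ExpLipschitz n l r D f a m) (ht : 0 ≤ t) (hx : ContinuousOn x (Icc (-r) 0)) (B : ℝ) :
    ∃ L, 0 ≤ L ∧ ∀ d φ η ε v y, IsSolFrom n l r D f t x d φ → 0 ≤ η → η ≤ 1 → 0 ≤ ε → ε ≤ B →
      (∀ u ∈ Icc t (t + η), ‖f u (fun θ => φ (u + θ)) (d u) - v‖ ≤ ε) →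
      ContinuousOn y (Icc (-r) 0) → histNorm n r y ≤ 1 →
      lyapSup n l r D f a (t + η) (fun θ => Eop n x η v θ + η • y θ) ≤
        Real.exp (-η) * lyapSup n l r D f a t x + L * (η * (ε + histNorm n r y)) := by
  obtain ⟨ρ, hρa, -, -, hρ⟩ := h.exists_uniform_bound (max t (histNorm n r x))
  obtain ⟨N, hN⟩ := exists_nat_ge (max (t + 1) (ρ 0 + |B| + 1))
  refine ⟨m N, hm N, fun d φ η ε v y hφ hη hη1 hε hεB hv hy hy1 => ?_⟩
  have hs : t ≤ t + η := by linarith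
  have hX : ContinuousOn (fun θ => Eop n x η v θ + η • y θ) (Icc (-r) 0) :=
    (continuousOn_Eop hr hx hη v).add (hy.const_smul η)
  have hψ := continuousOn_hist hφ.2.1.1 hs
  have hdist := hφ.histNorm_Eop_sub_le hr hη hε hv hy
  have hψN : histNorm n r (fun θ => φ (t + η + θ)) ≤ ρ 0 :=
    (hρ t x d φ (t + η) ⟨ht, le_max_left _ _⟩ hx (le_max_right _ _) hφ hs).trans
      (hρa self_mem_Ici (sub_nonneg.2 hs) (sub_nonneg.2 hs))
  have hN2 : ρ 0 + |B| + 1 ≤ N := (le_max_right _ _).trans hN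
  have hXN := histNorm_le_add hX hψ
  have hsmall : η * (ε + histNorm n r y) ≤ |B| + 1 := by
    have := histNorm_nonneg (r := r) y
    nlinarith [le_abs_self B]
  have e1 := lyapSup_le_add hD h ha hlip (N := N)
    ⟨ht.trans hs, by linarith [(le_max_left _ _).trans hN]⟩ hX hψ (by linarith)
    (by linarith [abs_nonneg B])
  have e2 := lyapSup_hist_le hr hD h3 h ha hlip ht hx hφ hs
  rw [add_sub_cancel_left] at e2
  have e3 := mul_le_mul_of_nonneg_left hdist (hm N)
  linarith

theorem Vdot_le_of_forall {V : ℝ → (ℝ → Euc n) → ℝ} {v : Euc n} {c : ℝ}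
    (H : ∀ ε > 0, ∃ δ > 0, ∀ η y, 0 < η → η < δ → ContinuousOn y (Icc (-r) 0) →
      histNorm n r y < δ →
        V (t + η) (fun θ => Eop n x η v θ + η • y θ) - V t x ≤ (c + ε) * η) :
    Vdot n r V t x v ≤ (c : EReal) := by
  refine EReal.le_of_forall_lt_iff_le.1 fun z hz => ?_
  have hz' : c < z := EReal.coe_lt_coe_iff.1 hz
  obtain ⟨δ, hδ, hV⟩ := H (z - c) (sub_pos.2 hz')
  refine (iInf_le _ ⟨δ, hδ⟩).trans (iSup_le ?_)
  rintro ⟨⟨η, y⟩, h0, hlt, hy, hyδ⟩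
  rw [EReal.coe_le_coe_iff, div_le_iff₀ h0]
  simpa using hV η y h0 hlt hy hyδ

variable {γ : ℝ → ℝ}

/-- Decrease estimate at times where the velocity of some solution is right-continuous. -/
theorem Vdot_mul_lyapSup_le_of_tendsto (hr : 0 ≤ r) (hD : D.Nonempty) (h3 : H3 n l r D f)
    (h : RGASnu n l r D f) (ha : IsKInf a) (hm : ∀ N, 0 ≤ m N)
    (hlip : ExpLipschitz n l r D f a m) (ht : 0 ≤ t) (hx : ContinuousOn x (Icc (-r) 0))
    (hγ : Antitone γ) (hγ1 : ∀ t, 1 ≤ γ t) (hγ3 : ∀ t, γ t ≤ 3)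
    {d : ℝ → Euc l} {φ : ℝ → Euc n} (hφ : IsSolFrom n l r D f t x d φ) {v : Euc n}
    (hv : ∀ ε > 0, ∃ δ > 0, ∀ u, t ≤ u → u < t + δ →
      ‖f u (fun θ => φ (u + θ)) (d u) - v‖ ≤ ε) :
    Vdot n r (fun t x => γ t * lyapSup n l r D f a t x) t x v ≤
      ((-(γ t * lyapSup n l r D f a t x) : ℝ) : EReal) := by
  obtain ⟨L, hL, hE⟩ := exists_lyapSup_Eop_le hr hD h3 h ha hm hlip ht hx 1
  have hW := lyapSup_nonneg hD h ha hlip ht hx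
  refine Vdot_le_of_forall fun ε hε => ?_
  set W := lyapSup n l r D f a t x with hWdef
  set ε' := min 1 (ε / (12 * (L + 1))) with hε'
  have hε'0 : 0 < ε' := by positivity
  have hLε : L * ε' ≤ ε / 12 := by
    have : ε' ≤ ε / (12 * (L + 1)) := min_le_right _ _
    rw [le_div_iff₀ (by positivity)] at this
    nlinarith
  obtain ⟨δ, hδ, hvδ⟩ := hv ε' hε'0
  refine ⟨min (min δ ε') (ε / (6 * (W + 1))), by positivity, fun η y hη hηδ hy hyδ => ?_⟩
  simp only [lt_min_iff] at hηδ hyδ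
  obtain ⟨⟨hη1, hη2⟩, hη3⟩ := hηδ
  have hε'1 : ε' ≤ 1 := min_le_left _ _
  have hηW : η * W ≤ ε / 6 := by
    rw [lt_div_iff₀ (by positivity)] at hη3
    nlinarith
  have e := hE d φ η ε' v y hφ hη.le (by linarith) hε'0.le hε'1
    (fun u hu => hvδ u hu.1 (by linarith [hu.2])) hy (by linarith)
  set W' := lyapSup n l r D f a (t + η) (fun θ => Eop n x η v θ + η • y θ) with hW'
  have hW'0 : 0 ≤ W' := lyapSup_nonneg hD h ha hlip (by linarith)
    ((continuousOn_Eop hr hx hη.le v).add (hy.const_smul η))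
  have hexp := Real.abs_exp_sub_one_sub_id_le (x := -η) (by
    rw [abs_neg, abs_of_pos hη]
    linarith)
  have hexp' : Real.exp (-η) ≤ 1 - η + η ^ 2 := by
    have := (le_abs_self _).trans hexp
    linarith [neg_sq η]
  have e1 : Real.exp (-η) * W ≤ (1 - η + η ^ 2) * W := mul_le_mul_of_nonneg_right hexp' hW
  have e2 : L * (η * (ε' + histNorm n r y)) ≤ η * (ε / 6) := by
    have : L * histNorm n r y ≤ L * ε' := mul_le_mul_of_nonneg_left hyδ.1.2.le hL
    nlinarith
  have e3 : η ^ 2 * W ≤ η * (ε / 6) := by nlinarith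
  have e4 : W' ≤ W - η * W + η * (ε / 3) := by nlinarith
  have e5 : γ (t + η) * W' ≤ γ t * W' := mul_le_mul_of_nonneg_right (hγ (by linarith)) hW'0
  have e6 : γ t * W' ≤ γ t * (W - η * W + η * (ε / 3)) :=
    mul_le_mul_of_nonneg_left e4 (by linarith [hγ1 t])
  have e7 : γ t * (η * (ε / 3)) ≤ 3 * (η * (ε / 3)) :=
    mul_le_mul_of_nonneg_right (hγ3 t) (by positivity)
  change γ (t + η) * W' - γ t * W ≤ _
  nlinarith

theorem exists_mul_le_sqrt_mul {p q : ℝ} (hp : 0 < p) (hq : 0 < q) :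
    ∃ δ > 0, ∀ η, 0 < η → η < δ → η * p ≤ √η * q := by
  refine ⟨(q / p) ^ 2, by positivity, fun η hη hηδ => ?_⟩
  have hsqrt : √η * p ≤ q := by
    rw [← le_div_iff₀ hp]
    exact (Real.sqrt_le_left (by positivity)).2 hηδ.le
  calc η * p = √η * (√η * p) := by rw [← mul_assoc, Real.mul_self_sqrt hη.le]
    _ ≤ _ := mul_le_mul_of_nonneg_left hsqrt (Real.sqrt_nonneg _)

/-- Decrease estimate at times where the right derivative of the gauge is `-∞`. -/
theorem Vdot_mul_lyapSup_le_of_sqrt (hr : 0 ≤ r) (hD : D.Nonempty) (h2 : H2 n l r D f)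
    (h3 : H3 n l r D f) (h : RGASnu n l r D f) (ha : IsKInf a) (hm : ∀ N, 0 ≤ m N)
    (hlip : ExpLipschitz n l r D f a m) (ht : 0 ≤ t) (hx : ContinuousOn x (Icc (-r) 0))
    (hx0 : 0 < histNorm n r x) (hγ1 : ∀ t, 1 ≤ γ t) (hγ3 : ∀ t, γ t ≤ 3) {κ : ℝ} (hκ : 0 < κ)
    (hγκ : ∀ η ∈ Ioo (0 : ℝ) 1, γ (t + η) ≤ γ t - κ * √η) (v : Euc n) :
    Vdot n r (fun t x => γ t * lyapSup n l r D f a t x) t x v ≤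
      ((-(γ t * lyapSup n l r D f a t x) : ℝ) : EReal) := by
  obtain ⟨C, hC, hCb⟩ := exists_bound_rhs h2 h (max t (histNorm n r x)) (t + 1)
  obtain ⟨d, hd⟩ := hD
  obtain ⟨φ, hφ⟩ := h.exists_isSolFrom ht hx (MD.const hd)
  have hD : D.Nonempty := ⟨d, hd⟩
  obtain ⟨L, hL, hE⟩ := exists_lyapSup_Eop_le hr hD h3 h ha hm hlip ht hx (C + ‖v‖)
  have hW : 0 < lyapSup n l r D f a t x := by
    have e := ha.2.1 self_mem_Ici (mem_Ici.2 hx0.le) hx0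
    rw [ha.2.2.1] at e
    exact e.trans_le (apply_histNorm_le_lyapSup hD h ha hlip ht hx)
  refine Vdot_le_of_forall fun ε hε => ?_
  set W := lyapSup n l r D f a t x with hWdef
  have hγt := hγ1 t
  set Q := γ t * W + 3 * (L * (C + ‖v‖ + 1)) with hQ
  have hQ0 : 0 < Q := by positivity
  obtain ⟨δ, hδ, hδQ⟩ := exists_mul_le_sqrt_mul hQ0 (mul_pos hκ hW)
  refine ⟨min 1 δ, lt_min one_pos hδ, fun η y hη hηδ hy hyδ => ?_⟩
  rw [lt_min_iff] at hηδ hyδ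
  have hηQ := hδQ η hη hηδ.2
  have hvel : ∀ u ∈ Icc t (t + η), ‖f u (fun θ => φ (u + θ)) d - v‖ ≤ C + ‖v‖ := fun u hu => by
    have := hCb t x (fun _ => d) φ u ⟨ht, le_max_left _ _⟩ hx (le_max_right _ _) hφ hu.1
      (by linarith [hu.2, hηδ.1])
    linarith [norm_sub_le (f u (fun θ => φ (u + θ)) d) v]
  have e := hE (fun _ => d) φ η (C + ‖v‖) v y hφ hη.le hηδ.1.le (by positivity) le_rfl hvel hy
    hyδ.1.le
  set W' := lyapSup n l r D f a (t + η) (fun θ => Eop n x η v θ + η • y θ) with hW'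
  have e1 : Real.exp (-η) * W ≤ W :=
    mul_le_of_le_one_left hW.le (Real.exp_le_one_iff.2 (by linarith))
  have e2 : L * (η * (C + ‖v‖ + histNorm n r y)) ≤ η * (L * (C + ‖v‖ + 1)) := by
    rw [mul_left_comm]
    gcongr
    exact hyδ.1.le
  have e3 := hγκ η ⟨hη, hηδ.1⟩
  have e4 : γ (t + η) * W' ≤ γ (t + η) * (W + η * (L * (C + ‖v‖ + 1))) :=
    mul_le_mul_of_nonneg_left (by linarith) (by linarith [hγ1 (t + η)])
  have e5 : γ (t + η) * W ≤ (γ t - κ * √η) * W := mul_le_mul_of_nonneg_right e3 hW.le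
  have e6 : γ (t + η) * (η * (L * (C + ‖v‖ + 1))) ≤ 3 * (η * (L * (C + ‖v‖ + 1))) :=
    mul_le_mul_of_nonneg_right (hγ3 _) (by positivity)
  change γ (t + η) * W' - γ t * W ≤ _
  have e7 : 0 ≤ ε * η := by positivity
  rw [hQ] at hηQ
  linarith

theorem Vdot_mul_lyapSup_le (hr : 0 ≤ r) (hD : D.Nonempty) (h2 : H2 n l r D f)
    (h3 : H3 n l r D f) (hf0 : ∀ t d, 0 ≤ t → d ∈ D → f t (fun _ => (0 : Euc n)) d = 0)
    (h : RGASnu n l r D f) (ha : IsKInf a) (hm : ∀ N, 0 ≤ m N)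
    (hlip : ExpLipschitz n l r D f a m) {A : Set ℝ}
    (hc : ∀ t x d, 0 ≤ t → t ∉ A → ContinuousOn x (Icc (-r) 0) → d ∈ D →
      ∀ ε > 0, ∃ δ > 0, ∀ t' x' d', 0 ≤ t' → ContinuousOn x' (Icc (-r) 0) → d' ∈ D →
        |t' - t| < δ → histNorm n r (x' - x) < δ → ‖d' - d‖ < δ →
          ‖f t' x' d' - f t x d‖ < ε)
    (hγ : Antitone γ) (hγ1 : ∀ t, 1 ≤ γ t) (hγ3 : ∀ t, γ t ≤ 3)
    (hγA : ∀ t ∈ A, 0 ≤ t → ∃ κ > 0, ∀ η ∈ Ioo (0 : ℝ) 1, γ (t + η) ≤ γ t - κ * √η)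
    (ht : 0 ≤ t) (hx : ContinuousOn x (Icc (-r) 0)) {d : Euc l} (hd : d ∈ D) :
    Vdot n r (fun t x => γ t * lyapSup n l r D f a t x) t x (f t x d) ≤
      ((-(γ t * lyapSup n l r D f a t x) : ℝ) : EReal) := by
  obtain ⟨φ, hφ⟩ := h.exists_isSolFrom ht hx (MD.const hd)
  have hinit : f t (fun θ => φ (t + θ)) d = f t x d :=
    h3.eq_of_eqOn ht (continuousOn_hist hφ.2.1.1 le_rfl) hd hφ.2.2
  by_cases hA : t ∈ A
  · rcases (histNorm_nonneg (r := r) x).eq_or_lt with hx0 | hx0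
    · refine Vdot_mul_lyapSup_le_of_tendsto hr hD h3 h ha hm hlip ht hx hγ hγ1 hγ3 hφ
        fun ε hε => ⟨1, one_pos, fun u hu _ => ?_⟩
      have hzero : ∀ s, t ≤ s → f s (fun θ => φ (s + θ)) d = 0 := fun s hs => by
        have hcont := continuousOn_hist hφ.2.1.1 hs
        rw [h3.eq_of_eqOn (ht.trans hs) hcont hd (y := fun _ => 0) fun θ hθ => ?_,
          hf0 s d (ht.trans hs) hd]
        have := norm_le_histNorm hcont hθ
        rw [h.histNorm_eq_zero ht hx hφ hx0.symm hs] at this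
        exact norm_le_zero_iff.1 this
      rw [hzero u hu, ← hinit, hzero t le_rfl, sub_zero, norm_zero]
      exact hε.le
    · obtain ⟨κ, hκ, hγκ⟩ := hγA t hA ht
      exact Vdot_mul_lyapSup_le_of_sqrt hr hD h2 h3 h ha hm hlip ht hx hx0 hγ1 hγ3 hκ hγκ _
  · refine Vdot_mul_lyapSup_le_of_tendsto hr hD h3 h ha hm hlip ht hx hγ hγ1 hγ3 hφ
      fun ε hε => ?_
    obtain ⟨δ, hδ, hcl⟩ := exists_norm_rhs_sub_lt hc ht le_rfl hA hφ.1.1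
      (fun ε hε => ⟨1, one_pos, fun _ _ _ => by simpa using hε⟩) hφ.2.1.1 hε
    refine ⟨δ, hδ, fun u hu huδ => ?_⟩
    rw [← hinit]
    refine (hcl u hu ?_).le
    rw [abs_of_nonneg (sub_nonneg.2 hu)]
    linarith

theorem exists_abs_mul_lyapSup_sub_lt (hr : 0 ≤ r) (hD : D.Nonempty) (h2 : H2 n l r D f)
    (h3 : H3 n l r D f) (h : RGASnu n l r D f) (ha : IsKInf a) {C : ℝ} (hC : 0 ≤ C)
    (haC : ∀ s s', |a s - a s'| ≤ C * |s - s'|) (hm : ∀ N, 0 ≤ m N)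
    (hlip : ExpLipschitz n l r D f a m) (hγc : Continuous γ) (hγ1 : ∀ t, 1 ≤ γ t)
    (hγ3 : ∀ t, γ t ≤ 3) (ht : 0 ≤ t) (hx : ContinuousOn x (Icc (-r) 0)) {ε : ℝ} (hε : 0 < ε) :
    ∃ δ > 0, ∀ t' x', 0 ≤ t' → ContinuousOn x' (Icc (-r) 0) →
      |t' - t| + histNorm n r (x' - x) < δ →
        |γ t' * lyapSup n l r D f a t' x' - γ t * lyapSup n l r D f a t x| < ε := by
  have hW := lyapSup_nonneg hD h ha hlip ht hx
  set W := lyapSup n l r D f a t x with hWdef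
  obtain ⟨N, hN⟩ := exists_nat_ge (max (t + 1) (histNorm n r x + 1))
  have htN : t + 1 ≤ N := (le_max_left _ _).trans hN
  have hxN : histNorm n r x + 1 ≤ N := (le_max_right _ _).trans hN
  have hmN := hm N
  obtain ⟨δ₁, hδ₁, hγδ⟩ := Metric.continuous_iff.1 hγc t (ε / (4 * (W + 1))) (by positivity)
  obtain ⟨δ₂, hδ₂, hWδ⟩ := exists_abs_lyapSup_sub_lt hr hD h2 h3 h ha hC haC hm hlip ht hx
    (show 0 < ε / 12 by positivity)
  refine ⟨min (min 1 (ε / (12 * (m N + 1)))) (min δ₁ δ₂), by positivity,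
    fun t' x' ht' hx' hlt => ?_⟩
  simp only [lt_min_iff] at hlt
  obtain ⟨⟨hlt1, hlt2⟩, hlt3, hlt4⟩ := hlt
  have hnn := histNorm_nonneg (r := r) (x' - x)
  have hnt := abs_nonneg (t' - t)
  have e1 := hγδ t' (by
    rw [Real.dist_eq]
    linarith)
  rw [Real.dist_eq, lt_div_iff₀ (by positivity)] at e1
  have e2 := hWδ t' ht' (by linarith)
  have e3 := abs_lyapSup_sub_le hD h ha hlip (N := N)
    ⟨ht', by linarith [le_abs_self (t' - t)]⟩ hx' hx
    (by linarith [histNorm_le_add hx' hx]) (by linarith)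
  have e4 : m N * histNorm n r (x' - x) ≤ ε / 12 := by
    rw [lt_div_iff₀ (by positivity)] at hlt2
    nlinarith
  have e5 : γ t' * lyapSup n l r D f a t' x' - γ t * W =
      γ t' * (lyapSup n l r D f a t' x' - lyapSup n l r D f a t' x) +
        γ t' * (lyapSup n l r D f a t' x - W) + (γ t' - γ t) * W := by ring
  have hγabs : |γ t'| ≤ 3 := abs_le.2 ⟨by linarith [hγ1 t'], hγ3 t'⟩
  rw [e5]
  refine (abs_add_three _ _ _).trans_lt ?_
  rw [abs_mul, abs_mul, abs_mul, abs_of_nonneg hW]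
  have e6 := mul_le_mul hγabs (e3.trans e4) (abs_nonneg _) (by norm_num)
  have e7 := mul_le_mul hγabs e2.le (abs_nonneg _) (by norm_num)
  nlinarith [abs_nonneg (γ t' - γ t)]

end Derivative

theorem isKInf_mul_self {b : ℝ → ℝ} (hbc : Continuous b) (hbm : Monotone b)
    (hb1 : ∀ s, 1 ≤ b s) : IsKInf fun u => u * b u := by
  refine ⟨by fun_prop, fun u hu v hv huv => ?_, by simp,
    fun s hs => mul_nonneg hs (by linarith [hb1 s]), ?_⟩
  · have e1 := hbm huv.le
    have e2 := hb1 u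
    have hu' : 0 ≤ u := hu
    dsimp only
    nlinarith
  · refine tendsto_atTop_mono' _ ?_ tendsto_id
    filter_upwards [eventually_ge_atTop 0] with s hs
    exact le_mul_of_one_le_right hs (hb1 s)

/-- **Theorem 2.9, (a) ⇒ (b), converse Lyapunov theorem.** Under hypotheses
(H1)-(H4), if `0` is non-uniformly in time RGAS then there is a continuous Lyapunov
functional `V` with `K∞` bounds, the infinitesimal decrease property
`V⁰(t,x;f(t,x,d)) ≤ -V(t,x)`, and a local Lipschitz property. -/
theorem stmt8 (n l : ℕ) (r : ℝ) (hr : 0 ≤ r) (D : Set (Euc l)) (hD : D.Nonempty)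
    (f : ℝ → (ℝ → Euc n) → Euc l → Euc n)
    (hf0 : ∀ t d, 0 ≤ t → d ∈ D → f t (fun _ => (0 : Euc n)) d = 0)
    (h1 : H1 n l r D f) (h2 : H2 n l r D f) (h3 : H3 n l r D f) (h4 : H4 n l r D f)
    (hrgas : RGASnu n l r D f) :
    ∃ V : ℝ → (ℝ → Euc n) → ℝ,
      (∀ t x, 0 ≤ t → ContinuousOn x (Icc (-r) 0) → ∀ ε > 0, ∃ δ > 0,
        ∀ t' x', 0 ≤ t' → ContinuousOn x' (Icc (-r) 0) →
          |t' - t| + histNorm n r (x' - x) < δ → |V t' x' - V t x| < ε) ∧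
      (∀ t x, 0 ≤ t → ContinuousOn x (Icc (-r) 0) → 0 ≤ V t x) ∧
      (∃ a₁ a₂ β, IsKInf a₁ ∧ IsKInf a₂ ∧ IsKPlus β ∧
        ∀ t x, 0 ≤ t → ContinuousOn x (Icc (-r) 0) →
          a₁ (histNorm n r x) ≤ V t x ∧ V t x ≤ a₂ (β t * histNorm n r x)) ∧
      (∀ t x d, 0 ≤ t → ContinuousOn x (Icc (-r) 0) → d ∈ D →
        Vdot n r V t x (f t x d) ≤ ((-(V t x) : ℝ) : EReal)) ∧
      (∃ M : ℝ → ℝ, (∀ R, 0 ≤ R → 0 ≤ M R) ∧ MonotoneOn M (Ici 0) ∧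
        ∀ R, 0 ≤ R → ∀ t x y, t ∈ Icc 0 R →
          ContinuousOn x (Icc (-r) 0) → ContinuousOn y (Icc (-r) 0) →
          histNorm n r x ≤ R → histNorm n r y ≤ R →
          |V t y - V t x| ≤ M R * histNorm n r (y - x)) := by
  obtain ⟨a, C, m, ha, hC, hm, haC, hlip⟩ := exists_isKInf_lipschitz hr h1 h3 hrgas
  replace hlip : ExpLipschitz n l r D f a m := hlip
  obtain ⟨A, hA, hc, -⟩ := id h3
  obtain ⟨γ, hγc, hγ, hγ1, hγ3, hγA⟩ :=
    exists_gauge (countable_inter_Ici_of_finite_inter_Icc hA)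
  set M : ℝ → ℝ := fun R => 3 * ∑ k ∈ Finset.range (⌈R⌉₊ + 1), m k with hMdef
  have hMm : Monotone M := fun R S hRS => by
    refine mul_le_mul_of_nonneg_left ?_ (by norm_num)
    exact Finset.sum_le_sum_of_subset_of_nonneg
      (Finset.range_mono (Nat.succ_le_succ (Nat.ceil_mono hRS))) fun k _ _ => hm k
  have hM0 : ∀ R, 0 ≤ M R := fun R =>
    mul_nonneg (by norm_num) (Finset.sum_nonneg fun k _ => hm k)
  have hMle : ∀ R, 3 * m ⌈R⌉₊ ≤ M R := fun R =>
    mul_le_mul_of_nonneg_left (Finset.single_le_sum (fun k _ => hm k)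
      (Finset.mem_range.2 (Nat.lt_succ_self _))) (by norm_num)
  obtain ⟨b₀, hb₀c, hb₀m, hMb⟩ := hMm.exists_continuous_majorant
  set b : ℝ → ℝ := fun s => 1 + b₀ s with hb
  have hbc : Continuous b := by fun_prop
  have hbm : Monotone b := hb₀m.const_add 1
  have hb1 : ∀ s, 1 ≤ b s := fun s => by linarith [hM0 s, hMb s]
  have hW0 : ∀ t x, 0 ≤ t → ContinuousOn x (Icc (-r) 0) → 0 ≤ lyapSup n l r D f a t x :=
    fun t x ht hx => lyapSup_nonneg hD hrgas ha hlip ht hx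
  refine ⟨fun t x => γ t * lyapSup n l r D f a t x, ?_, ?_, ⟨a, fun u => u * b u, b, ha,
    isKInf_mul_self hbc hbm hb1, ⟨hbc.continuousOn, fun t _ => by linarith [hb1 t]⟩, ?_⟩, ?_,
    M, fun R _ => hM0 R, hMm.monotoneOn _, ?_⟩
  · exact fun t x ht hx ε hε => exists_abs_mul_lyapSup_sub_lt hr hD h2 h3 hrgas ha hC haC hm hlip
      hγc hγ1 hγ3 ht hx hε
  · exact fun t x ht hx => mul_nonneg (by linarith [hγ1 t]) (hW0 t x ht hx)
  · intro t x ht hx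
    refine ⟨(apply_histNorm_le_lyapSup hD hrgas ha hlip ht hx).trans
      (le_mul_of_one_le_left (hW0 t x ht hx) (hγ1 t)), ?_⟩
    have hs := histNorm_nonneg (r := r) x
    set s := histNorm n r x with hsdef
    have hle := Nat.le_ceil (max t s)
    have e1 := lyapSup_le hD hrgas ha hlip (N := ⌈max t s⌉₊) ⟨ht, (le_max_left _ _).trans hle⟩ hx
      ((le_max_right _ _).trans hle)
    have e2 : γ t * lyapSup n l r D f a t x ≤ 3 * (m ⌈max t s⌉₊ * s) :=
      mul_le_mul (hγ3 t) e1 (hW0 t x ht hx) (by norm_num)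
    have hbmax : b (max t s) ≤ b t * b (b t * s) := by
      have hbs : b s ≤ b (b t * s) := hbm (le_mul_of_one_le_left hs (hb1 t))
      rw [hbm.map_max]
      refine max_le ?_ ?_
      · nlinarith [hb1 t, hb1 (b t * s)]
      · nlinarith [hb1 t, hb1 (b t * s)]
    have e3 : 3 * m ⌈max t s⌉₊ ≤ b (max t s) := by linarith [hMle (max t s), hMb (max t s)]
    have e4 := mul_le_mul_of_nonneg_right (e3.trans hbmax) hs
    dsimp only
    linarith
  · exact fun t x d ht hx hd => Vdot_mul_lyapSup_le hr hD h2 h3 hf0 hrgas ha hm hlip hc hγ hγ1 hγ3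
      hγA ht hx hd
  · intro R hR t x y ht hx hy hxR hyR
    have hle := Nat.le_ceil R
    have e1 := abs_lyapSup_sub_le hD hrgas ha hlip (N := ⌈R⌉₊) ⟨ht.1, ht.2.trans hle⟩ hy hx
      (hyR.trans hle) (hxR.trans hle)
    have hγ0 : 0 ≤ γ t := by linarith [hγ1 t]
    rw [← mul_sub, abs_mul, abs_of_nonneg hγ0]
    have e2 := mul_le_mul (hγ3 t) e1 (abs_nonneg _) (by norm_num)
    have e3 := mul_le_mul_of_nonneg_right (hMle R) (histNorm_nonneg (r := r) (y - x))
    linarith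

end
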